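/- arXiv:1012.6012 — 2 statements merged into one kernel-verified Lean document; each statement's English description precedes it below -/
import Mathlib

section
/- (Theorem 2, achievability) For every lossy Gray–Wyner source coding setup with side-information, R_LGW^{inner} ⊆ R_LGW, i.e., every rate triple in R_LGW^{inner} is achievable. -/
open scoped BigOperators Classical

noncomputable section

namespace BCFB

variable {Ω A B C : Type*}

/-- Probability of an event under a weight function on a finite sample space. -/
def prOf [Fintype Ω] (w : Ω → ℝ) (E : Ω → Prop) : ℝ :=
  ∑ ω, if E ω then w ω else 0

/-- Distribution (pushforward) of a random variable. -/
def distOf [Fintype Ω] (w : Ω → ℝ) (X : Ω → A) : A → ℝ :=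
  fun a => prOf w fun ω => X ω = a

/-- Shannon entropy (base 2) of a random variable. -/
def entOf [Fintype Ω] [Fintype A] (w : Ω → ℝ) (X : Ω → A) : ℝ :=
  -∑ a, distOf w X a * Real.logb 2 (distOf w X a)

/-- Mutual information (base 2). -/
def miOf [Fintype Ω] [Fintype A] [Fintype B] (w : Ω → ℝ) (X : Ω → A) (Y : Ω → B) : ℝ :=
  entOf w X + entOf w Y - entOf w fun ω => (X ω, Y ω)

/-- Conditional mutual information I(X;Y|Z) (base 2). -/
def cmiOf [Fintype Ω] [Fintype A] [Fintype B] [Fintype C]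
    (w : Ω → ℝ) (X : Ω → A) (Y : Ω → B) (Z : Ω → C) : ℝ :=
  entOf w (fun ω => (X ω, Z ω)) + entOf w (fun ω => (Y ω, Z ω))
    - entOf w (fun ω => (X ω, Y ω, Z ω)) - entOf w Z

/-- `w` is a probability mass function. -/
def IsPMF [Fintype Ω] (w : Ω → ℝ) : Prop := (∀ ω, 0 ≤ w ω) ∧ ∑ ω, w ω = 1

/-- `k` is a transition kernel (each row a pmf). -/
def IsKernel {A B : Type*} [Fintype A] [Fintype B] (k : A → B → ℝ) : Prop :=
  ∀ a, IsPMF (k a)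

/-- `X — Y — Z` forms a Markov chain (i.e. `X` and `Z` are conditionally
independent given `Y`). -/
def MarkovChain [Fintype Ω] (w : Ω → ℝ) (X : Ω → A) (Y : Ω → B) (Z : Ω → C) : Prop :=
  ∀ a b c,
    distOf w (fun ω => (X ω, Y ω, Z ω)) (a, b, c) * distOf w Y b
      = distOf w (fun ω => (X ω, Y ω)) (a, b) * distOf w (fun ω => (Z ω, Y ω)) (c, b)

/-- `X` and `Y` are independent. -/
def IndepRV [Fintype Ω] (w : Ω → ℝ) (X : Ω → A) (Y : Ω → B) : Prop :=
  ∀ a b, distOf w (fun ω => (X ω, Y ω)) (a, b) = distOf w X a * distOf w Y b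

/-- Number of messages of rate `R` and blocklength `n`: `⌊2^{nR}⌋`. -/
def msgCard (n : ℕ) (R : ℝ) : ℕ := ⌊(2 : ℝ) ^ ((n : ℝ) * R)⌋₊

/-- Binary entropy function. -/
def hb (u : ℝ) : ℝ := -(u * Real.logb 2 u) - (1 - u) * Real.logb 2 (1 - u)

/-- Empirical frequency of the letter `a` in the sequence `x`. -/
def freqOf {A : Type*} {n : ℕ} (x : Fin n → A) (a : A) : ℝ :=
  ((Finset.univ.filter fun t => x t = a).card : ℝ) / n

/-- `ε`-typicality of a sequence w.r.t. a pmf `P`. -/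
def Typical {A : Type*} (ε : ℝ) {n : ℕ} (P : A → ℝ) (x : Fin n → A) : Prop :=
  ∀ a, |freqOf x a - P a| ≤ ε * P a

section NoFB

variable {X Y1 Y2 : Type*} [Fintype X] [Fintype Y1] [Fintype Y2]

/-- Error probability of a blocklength-`n` no-feedback code over the DMBC `W`. -/
def errProbNoFB (W : X → Y1 × Y2 → ℝ) (n : ℕ) (R0 R1 R2 : ℝ)
    (enc : Fin (msgCard n R0) × Fin (msgCard n R1) × Fin (msgCard n R2) → Fin n → X)
    (dec1 : (Fin n → Y1) → Fin (msgCard n R0) × Fin (msgCard n R1))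
    (dec2 : (Fin n → Y2) → Fin (msgCard n R0) × Fin (msgCard n R2)) : ℝ :=
  (1 / ((msgCard n R0 : ℝ) * (msgCard n R1 : ℝ) * (msgCard n R2 : ℝ))) *
    ∑ m : Fin (msgCard n R0) × Fin (msgCard n R1) × Fin (msgCard n R2),
      ∑ y : Fin n → Y1 × Y2,
        (∏ t, W (enc m t) (y t)) *
          (if dec1 (fun t => (y t).1) ≠ (m.1, m.2.1) ∨ dec2 (fun t => (y t).2) ≠ (m.1, m.2.2)
            then 1 else 0)

/-- Achievability of a rate triple over the DMBC `W` without feedback. -/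
def AchievableNoFB (W : X → Y1 × Y2 → ℝ) (R0 R1 R2 : ℝ) : Prop :=
  0 ≤ R0 ∧ 0 ≤ R1 ∧ 0 ≤ R2 ∧
    ∃ enc : (n : ℕ) →
        Fin (msgCard n R0) × Fin (msgCard n R1) × Fin (msgCard n R2) → Fin n → X,
    ∃ dec1 : (n : ℕ) → (Fin n → Y1) → Fin (msgCard n R0) × Fin (msgCard n R1),
    ∃ dec2 : (n : ℕ) → (Fin n → Y2) → Fin (msgCard n R0) × Fin (msgCard n R2),
      Filter.Tendsto (fun n => errProbNoFB W n R0 R1 R2 (enc n) (dec1 n) (dec2 n))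
        Filter.atTop (nhds 0)

/-- The no-feedback capacity region. -/
def CNoFB (W : X → Y1 × Y2 → ℝ) : Set (ℝ × ℝ × ℝ) :=
  closure {r | AchievableNoFB W r.1 r.2.1 r.2.2}

end NoFB

section FB

variable {X Y1 Y2 Yt : Type*} [Fintype X] [Fintype Y1] [Fintype Y2] [Fintype Yt]

/-- Causality: the time-`t` channel input depends only on feedback symbols before time `t`. -/
def Causal {X Yt : Type*} (n : ℕ) {M : Type*} (enc : Fin n → M → (Fin n → Yt) → X) : Prop :=
  ∀ (t : Fin n) (m : M) (fb fb' : Fin n → Yt),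
    (∀ s : Fin n, (s : ℕ) < (t : ℕ) → fb s = fb' s) → enc t m fb = enc t m fb'

/-- Error probability of a blocklength-`n` feedback code over the DMBC with
generalized feedback `W`. -/
def errProbFB (W : X → Y1 × Y2 × Yt → ℝ) (n : ℕ) (R0 R1 R2 : ℝ)
    (enc : Fin n → Fin (msgCard n R0) × Fin (msgCard n R1) × Fin (msgCard n R2) →
      (Fin n → Yt) → X)
    (dec1 : (Fin n → Y1) → Fin (msgCard n R0) × Fin (msgCard n R1))
    (dec2 : (Fin n → Y2) → Fin (msgCard n R0) × Fin (msgCard n R2)) : ℝ :=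
  (1 / ((msgCard n R0 : ℝ) * (msgCard n R1 : ℝ) * (msgCard n R2 : ℝ))) *
    ∑ m : Fin (msgCard n R0) × Fin (msgCard n R1) × Fin (msgCard n R2),
      ∑ y : Fin n → Y1 × Y2 × Yt,
        (∏ t, W (enc t m fun s => (y s).2.2) (y t)) *
          (if dec1 (fun t => (y t).1) ≠ (m.1, m.2.1) ∨
              dec2 (fun t => (y t).2.1) ≠ (m.1, m.2.2)
            then 1 else 0)

/-- Achievability of a rate triple over the DMBC with generalized feedback `W`. -/
def AchievableFB (W : X → Y1 × Y2 × Yt → ℝ) (R0 R1 R2 : ℝ) : Prop :=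
  0 ≤ R0 ∧ 0 ≤ R1 ∧ 0 ≤ R2 ∧
    ∃ enc : (n : ℕ) → Fin n →
        Fin (msgCard n R0) × Fin (msgCard n R1) × Fin (msgCard n R2) → (Fin n → Yt) → X,
    ∃ dec1 : (n : ℕ) → (Fin n → Y1) → Fin (msgCard n R0) × Fin (msgCard n R1),
    ∃ dec2 : (n : ℕ) → (Fin n → Y2) → Fin (msgCard n R0) × Fin (msgCard n R2),
      (∀ n, Causal n (enc n)) ∧
      Filter.Tendsto (fun n => errProbFB W n R0 R1 R2 (enc n) (dec1 n) (dec2 n))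
        Filter.atTop (nhds 0)

/-- Capacity region of the DMBC with generalized feedback `W`. -/
def CGenFB (W : X → Y1 × Y2 × Yt → ℝ) : Set (ℝ × ℝ × ℝ) :=
  closure {r | AchievableFB W r.1 r.2.1 r.2.2}

end FB

/-- Extension of a DMBC to a generalized-feedback channel with noiseless feedback
`Ỹ = (Y₁, Y₂)`. -/
def noiselessExt {X Y1 Y2 : Type*} (W : X → Y1 × Y2 → ℝ) :
    X → Y1 × Y2 × (Y1 × Y2) → ℝ :=
  fun x y => if y.2.2 = (y.1, y.2.1) then W x (y.1, y.2.1) else 0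

/-- Capacity region of a DMBC with noiseless feedback. -/
def CNoiselessFB {X Y1 Y2 : Type*} [Fintype X] [Fintype Y1] [Fintype Y2]
    (W : X → Y1 × Y2 → ℝ) : Set (ℝ × ℝ × ℝ) :=
  CGenFB (noiselessExt W)

section Marton

variable {X Y1 Y2 : Type*} [Fintype X] [Fintype Y1] [Fintype Y2]

/-- The single-letter Marton constraints for the rate triple `(R0,R1,R2)`. -/
def MartonCond (W : X → Y1 × Y2 → ℝ) (R0 R1 R2 : ℝ) : Prop :=
  ∃ (k0 k1 k2 : ℕ) (p : Fin k0 × Fin k1 × Fin k2 → ℝ)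
    (f : Fin k0 × Fin k1 × Fin k2 → X), IsPMF p ∧
    (let w : (Fin k0 × Fin k1 × Fin k2) × Y1 × Y2 → ℝ := fun z => p z.1 * W (f z.1) z.2
     let U0 := fun z : (Fin k0 × Fin k1 × Fin k2) × Y1 × Y2 => z.1.1
     let U1 := fun z : (Fin k0 × Fin k1 × Fin k2) × Y1 × Y2 => z.1.2.1
     let U2 := fun z : (Fin k0 × Fin k1 × Fin k2) × Y1 × Y2 => z.1.2.2
     let Yr1 := fun z : (Fin k0 × Fin k1 × Fin k2) × Y1 × Y2 => z.2.1
     let Yr2 := fun z : (Fin k0 × Fin k1 × Fin k2) × Y1 × Y2 => z.2.2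
     R0 < min (miOf w U0 Yr1) (miOf w U0 Yr2) ∧
     R0 + R1 < miOf w (fun z => (U0 z, U1 z)) Yr1 ∧
     R0 + R2 < miOf w (fun z => (U0 z, U2 z)) Yr2 ∧
     R0 + R1 + R2 < cmiOf w U1 Yr1 U0 + cmiOf w U2 Yr2 U0
       + min (miOf w U0 Yr1) (miOf w U0 Yr2) - cmiOf w U1 U2 U0)

/-- Marton's achievable region for the DMBC `W` without feedback. -/
def MartonRegion (W : X → Y1 × Y2 → ℝ) : Set (ℝ × ℝ × ℝ) :=
  closure {r | 0 ≤ r.1 ∧ 0 ≤ r.2.1 ∧ 0 ≤ r.2.2 ∧ MartonCond W r.1 r.2.1 r.2.2}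

end Marton

end BCFB
namespace BCFB

section LGW

variable {X Y1 Y2 V1 V2 : Type*} [Fintype X] [Fintype Y1] [Fintype Y2] [Fintype V1] [Fintype V2]

/-- Single-letter constraints defining the inner region `R_LGW^{inner}` for the
lossy Gray–Wyner problem with side information. -/
def LGWInnerCond (PXY : X × Y1 × Y2 → ℝ) (PV1 : X → V1 → ℝ) (PV2 : X → V2 → ℝ)
    (R0 R1 R2 : ℝ) : Prop :=
  ∃ (k : ℕ) (PV : X → Fin k × V1 × V2 → ℝ), IsKernel PV ∧
    (∀ x v1, ∑ v0 : Fin k, ∑ v2 : V2, PV x (v0, v1, v2) = PV1 x v1) ∧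
    (∀ x v2, ∑ v0 : Fin k, ∑ v1 : V1, PV x (v0, v1, v2) = PV2 x v2) ∧
    (let w : (X × Y1 × Y2) × Fin k × V1 × V2 → ℝ := fun z => PXY z.1 * PV z.1.1 z.2
     cmiOf w (fun z => z.1.1) (fun z => z.2.2.1) (fun z => (z.2.1, z.1.2.1)) < R1 ∧
     cmiOf w (fun z => z.1.1) (fun z => z.2.2.2) (fun z => (z.2.1, z.1.2.2)) < R2 ∧
     cmiOf w (fun z => z.1.1) (fun z => (z.2.1, z.2.2.1)) (fun z => z.1.2.1) < R0 + R1 ∧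
     cmiOf w (fun z => z.1.1) (fun z => (z.2.1, z.2.2.2)) (fun z => z.1.2.2) < R0 + R2)

/-- The region `R_LGW^{inner}`. -/
def LGWInner (PXY : X × Y1 × Y2 → ℝ) (PV1 : X → V1 → ℝ) (PV2 : X → V2 → ℝ) :
    Set (ℝ × ℝ × ℝ) :=
  closure {r | 0 ≤ r.1 ∧ 0 ≤ r.2.1 ∧ 0 ≤ r.2.2 ∧ LGWInnerCond PXY PV1 PV2 r.1 r.2.1 r.2.2}

/-- Single-letter constraints defining the region `R_LGW^{inner*}`. -/
def LGWInnerStarCond (PXY : X × Y1 × Y2 → ℝ) (PV1 : X → V1 → ℝ) (PV2 : X → V2 → ℝ)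
    (R0 R1 R2 : ℝ) : Prop :=
  ∃ (k : ℕ) (PV : X → Fin k × V1 × V2 → ℝ), IsKernel PV ∧
    (∀ x v1, ∑ v0 : Fin k, ∑ v2 : V2, PV x (v0, v1, v2) = PV1 x v1) ∧
    (∀ x v2, ∑ v0 : Fin k, ∑ v1 : V1, PV x (v0, v1, v2) = PV2 x v2) ∧
    (let w : (X × Y1 × Y2) × Fin k × V1 × V2 → ℝ := fun z => PXY z.1 * PV z.1.1 z.2
     max (cmiOf w (fun z => z.1.1) (fun z => z.2.1) (fun z => z.1.2.1))
         (cmiOf w (fun z => z.1.1) (fun z => z.2.1) (fun z => z.1.2.2)) < R0 ∧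
     cmiOf w (fun z => z.1.1) (fun z => z.2.2.1) (fun z => (z.2.1, z.1.2.1)) < R1 ∧
     cmiOf w (fun z => z.1.1) (fun z => z.2.2.2) (fun z => (z.2.1, z.1.2.2)) < R2)

/-- The region `R_LGW^{inner*}`. -/
def LGWInnerStar (PXY : X × Y1 × Y2 → ℝ) (PV1 : X → V1 → ℝ) (PV2 : X → V2 → ℝ) :
    Set (ℝ × ℝ × ℝ) :=
  closure {r | 0 ≤ r.1 ∧ 0 ≤ r.2.1 ∧ 0 ≤ r.2.2 ∧ LGWInnerStarCond PXY PV1 PV2 r.1 r.2.1 r.2.2}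

end LGW

end BCFB
namespace BCFB

section LGWCode

variable {X Y1 Y2 V1 V2 : Type*} [Fintype X] [Fintype Y1] [Fintype Y2] [Fintype V1] [Fintype V2]

/-- The `X`-marginal of a joint source law. -/
def PXmarg (PXY : X × Y1 × Y2 → ℝ) : X → ℝ := fun x => ∑ y1, ∑ y2, PXY (x, y1, y2)

/-- Probability that Receiver 1's reconstruction fails to be jointly `ε`-typical with
the source, for a blocklength-`n` LGW-SI code over the i.i.d. source `PXY`. -/
def lgwFail1 (PXY : X × Y1 × Y2 → ℝ) (PV1 : X → V1 → ℝ) (ε : ℝ) (n : ℕ) (R0 R1 R2 : ℝ)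
    (enc : (Fin n → X) → Fin (msgCard n R0) × Fin (msgCard n R1) × Fin (msgCard n R2))
    (rec1 : Fin (msgCard n R0) × Fin (msgCard n R1) → (Fin n → Y1) → Fin n → V1) : ℝ :=
  ∑ s : Fin n → X × Y1 × Y2,
    (∏ t, PXY (s t)) *
      (if ¬ Typical ε (fun xv : X × V1 => PXmarg PXY xv.1 * PV1 xv.1 xv.2)
            (fun t => ((s t).1,
              rec1 ((enc fun u => (s u).1).1, (enc fun u => (s u).1).2.1)
                (fun u => (s u).2.1) t))
        then 1 else 0)

/-- Probability that Receiver 2's reconstruction fails to be jointly `ε`-typical with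
the source. -/
def lgwFail2 (PXY : X × Y1 × Y2 → ℝ) (PV2 : X → V2 → ℝ) (ε : ℝ) (n : ℕ) (R0 R1 R2 : ℝ)
    (enc : (Fin n → X) → Fin (msgCard n R0) × Fin (msgCard n R1) × Fin (msgCard n R2))
    (rec2 : Fin (msgCard n R0) × Fin (msgCard n R2) → (Fin n → Y2) → Fin n → V2) : ℝ :=
  ∑ s : Fin n → X × Y1 × Y2,
    (∏ t, PXY (s t)) *
      (if ¬ Typical ε (fun xv : X × V2 => PXmarg PXY xv.1 * PV2 xv.1 xv.2)
            (fun t => ((s t).1,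
              rec2 ((enc fun u => (s u).1).1, (enc fun u => (s u).1).2.2)
                (fun u => (s u).2.2) t))
        then 1 else 0)

/-- `ε`-achievability of a rate triple for the LGW-SI problem. -/
def EpsAchievableLGW (PXY : X × Y1 × Y2 → ℝ) (PV1 : X → V1 → ℝ) (PV2 : X → V2 → ℝ)
    (ε : ℝ) (R0 R1 R2 : ℝ) : Prop :=
  ∃ enc : (n : ℕ) →
      (Fin n → X) → Fin (msgCard n R0) × Fin (msgCard n R1) × Fin (msgCard n R2),
  ∃ rec1 : (n : ℕ) → Fin (msgCard n R0) × Fin (msgCard n R1) → (Fin n → Y1) → Fin n → V1,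
  ∃ rec2 : (n : ℕ) → Fin (msgCard n R0) × Fin (msgCard n R2) → (Fin n → Y2) → Fin n → V2,
    Filter.Tendsto (fun n => lgwFail1 PXY PV1 ε n R0 R1 R2 (enc n) (rec1 n))
      Filter.atTop (nhds 0) ∧
    Filter.Tendsto (fun n => lgwFail2 PXY PV2 ε n R0 R1 R2 (enc n) (rec2 n))
      Filter.atTop (nhds 0)

/-- Achievability for the LGW-SI problem: `ε`-achievability for every `ε > 0`. -/
def AchievableLGW (PXY : X × Y1 × Y2 → ℝ) (PV1 : X → V1 → ℝ) (PV2 : X → V2 → ℝ)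
    (R0 R1 R2 : ℝ) : Prop :=
  0 ≤ R0 ∧ 0 ≤ R1 ∧ 0 ≤ R2 ∧
    ∀ ε : ℝ, 0 < ε → EpsAchievableLGW PXY PV1 PV2 ε R0 R1 R2

/-- The LGW-SI achievable region `R_LGW`. -/
def RLGW (PXY : X × Y1 × Y2 → ℝ) (PV1 : X → V1 → ℝ) (PV2 : X → V2 → ℝ) :
    Set (ℝ × ℝ × ℝ) :=
  closure {r | AchievableLGW PXY PV1 PV2 r.1 r.2.1 r.2.2}

end LGWCode

end BCFB
namespace BCFB
open Finset

/-- The real-valued indicator of a proposition. -/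
def ind (p : Prop) : ℝ := if p then 1 else 0

theorem ind_true {p : Prop} (h : p) : ind p = 1 := if_pos h

theorem ind_false {p : Prop} (h : ¬p) : ind p = 0 := if_neg h

theorem ind_nonneg (p : Prop) : 0 ≤ ind p := by unfold ind; split_ifs <;> norm_num

theorem ind_le_one (p : Prop) : ind p ≤ 1 := by unfold ind; split_ifs <;> norm_num

theorem ind_mono {p q : Prop} (h : p → q) : ind p ≤ ind q := by
  by_cases hp : p
  · rw [ind_true hp, ind_true (h hp)]
  · rw [ind_false hp]; exact ind_nonneg q

theorem ind_or_le (p q : Prop) : ind (p ∨ q) ≤ ind p + ind q := by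
  by_cases hp : p
  · rw [ind_true hp, ind_true (Or.inl hp)]; linarith [ind_nonneg q]
  · rw [ind_false hp, zero_add]; exact ind_mono fun h => h.resolve_left hp

section Averages

variable {ι A : Type*} [Fintype ι] [DecidableEq ι] [Fintype A]

theorem expect_funSplitAt (i : ι) (F : A → ({j // j ≠ i} → A) → ℝ) :
    𝔼 f : ι → A, F (f i) (fun j => f j) = 𝔼 a : A, 𝔼 g : {j // j ≠ i} → A, F a g := by
  rw [← Finset.expect_product', univ_product_univ]
  exact Fintype.expect_equiv (Equiv.funSplitAt i A) _ _ fun f => rfl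

/-- A coordinate of a uniformly distributed function is uniformly distributed. -/
theorem expect_apply [Nonempty A] (i : ι) (F : A → ℝ) :
    𝔼 f : ι → A, F (f i) = 𝔼 a, F a := by
  rw [expect_funSplitAt i fun a _ => F a]
  exact Finset.expect_congr rfl fun a _ => Fintype.expect_const _

/-- A uniformly distributed function collides at two distinct points with probability `1 / |A|`. -/
theorem expect_collision [Nonempty A] {i j : ι} (hij : i ≠ j) :
    𝔼 f : ι → A, ind (f i = f j) = 1 / Fintype.card A := by
  have h := expect_funSplitAt (A := A) i fun a g => ind (a = g ⟨j, hij.symm⟩)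
  rw [h, Finset.expect_comm]
  have h2 : ∀ g : {j // j ≠ i} → A, 𝔼 a : A, ind (a = g ⟨j, hij.symm⟩) = 1 / Fintype.card A := by
    intro g
    rw [Fintype.expect_eq_sum_div_card]
    simp [ind]
  simp_rw [h2]
  exact Fintype.expect_const _

theorem expect_fin_succ (M : ℕ) (h : (Fin (M + 1) → A) → ℝ) :
    𝔼 C : Fin (M + 1) → A, h C = 𝔼 a : A, 𝔼 C : Fin M → A, h (Fin.cons a C) := by
  rw [← Finset.expect_product', univ_product_univ]
  symm
  exact Fintype.expect_equiv (Fin.consEquiv fun _ => A) _ _ fun f => rfl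

end Averages

theorem one_sub_pow_le {p L : ℝ} (hp0 : 0 ≤ p) (hp1 : p ≤ 1) (hL : 0 < L) (hpL : p ≤ L) (M : ℕ) :
    (1 - p / L) ^ M ≤ 1 - p + Real.exp (-(M / L)) := by
  have h1 : (1 - p / L) ^ M ≤ Real.exp (p * (-(M / L))) := by
    calc (1 - p / L) ^ M ≤ (Real.exp (-(p / L))) ^ M := by
          apply pow_le_pow_left₀
          · have := (div_le_one hL).2 hpL; linarith
          · have := Real.add_one_le_exp (-(p / L)); linarith
      _ = _ := by rw [← Real.exp_nat_mul]; congr 1; ring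
  have h2 := convexOn_exp.2 (Set.mem_univ (0 : ℝ)) (Set.mem_univ (-(M / L) : ℝ))
    (sub_nonneg.2 hp1) hp0 (by ring)
  simp only [smul_eq_mul, mul_zero, zero_add, Real.exp_zero, mul_one] at h2
  have h3 : p * Real.exp (-(M / L)) ≤ 1 * Real.exp (-(M / L)) :=
    mul_le_mul_of_nonneg_right hp1 (Real.exp_pos _).le
  linarith

section Covering

variable {U : Type*} [Fintype U] [Nonempty U]

theorem covering_recursion {a g : U → ℝ} {B s r : ℝ} (ha0 : ∀ u, 0 ≤ a u) (ha1 : ∀ u, a u ≤ 1)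
    (hs : 𝔼 u, a u * g u = s) (hr : 𝔼 u, (1 - a u) = r) (M : ℕ) :
    ∀ h : (Fin M → U) → ℝ, (∀ C, h C ≤ B) → (∀ C m, h C ≤ g (C m)) →
      (1 - r) * 𝔼 C, h C ≤ s * (1 - r ^ M) + (1 - r) * B * r ^ M := by
  have hr1 : r ≤ 1 := by
    rw [← hr]; exact Finset.expect_le univ_nonempty fun u _ => by linarith [ha0 u]
  induction M with
  | zero =>
    intro h hB _
    have : 𝔼 C, h C ≤ B := Finset.expect_le univ_nonempty fun C _ => hB C
    simpa using mul_le_mul_of_nonneg_left this (sub_nonneg.2 hr1)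
  | succ M ih =>
    intro h hB hg
    set T := s * (1 - r ^ M) + (1 - r) * B * r ^ M with hT
    have key : ∀ u, (1 - r) * 𝔼 C : Fin M → U, h (Fin.cons u C)
        ≤ (1 - r) * (a u * g u) + (1 - a u) * T := by
      intro u
      have h1 := ih (fun C => h (Fin.cons u C)) (fun C => hB _)
        (fun C m => by simpa using hg (Fin.cons u C) m.succ)
      have h2 : 𝔼 C : Fin M → U, h (Fin.cons u C) ≤ g u :=
        Finset.expect_le univ_nonempty fun C _ => by simpa using hg (Fin.cons u C) 0
      have h3 := mul_le_mul_of_nonneg_left h1 (sub_nonneg.2 (ha1 u))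
      have h4 := mul_le_mul_of_nonneg_left h2 (mul_nonneg (sub_nonneg.2 hr1) (ha0 u))
      nlinarith
    rw [expect_fin_succ, Finset.mul_expect]
    refine (Finset.expect_le_expect fun u _ => key u).trans (le_of_eq ?_)
    rw [Finset.expect_add_distrib, ← Finset.mul_expect, ← Finset.expect_mul, hs, hr, hT]
    ring

/-- Covering: if each of `M` uniformly drawn codewords has cost `g`, then the cheapest one costs
on average hardly more than a letter drawn from `P`, once `M` exceeds the ratio `L` of `P` to the
uniform distribution. -/
theorem covering {P : U → ℝ} (hP : IsPMF P) {L B : ℝ} (hL : 0 < L) (hB : 0 ≤ B) {g : U → ℝ}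
    (hg0 : ∀ u, 0 ≤ g u) (hg : ∀ u, g u ≤ B) (M : ℕ) {h : (Fin M → U) → ℝ} (hhB : ∀ C, h C ≤ B)
    (hhg : ∀ C m, h C ≤ g (C m)) :
    𝔼 C, h C ≤ ∑ u, P u * (g u + (B - g u) * ind (L < Fintype.card U * P u))
      + B * Real.exp (-(M / L)) := by
  have hc : (0 : ℝ) < Fintype.card U := by exact_mod_cast Fintype.card_pos
  set w : U → ℝ := fun u => P u * (1 - ind (L < Fintype.card U * P u)) with hw
  have hw0 : ∀ u, 0 ≤ w u := fun u =>
    mul_nonneg (hP.1 u) (by linarith [ind_le_one (L < Fintype.card U * P u)])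
  have hwP : ∀ u, w u ≤ P u := fun u =>
    mul_le_of_le_one_right (hP.1 u) (by linarith [ind_nonneg (L < Fintype.card U * P u)])
  set p := ∑ u, w u with hp
  set s := ∑ u, w u * g u with hs
  have hp0 : 0 ≤ p := sum_nonneg fun u _ => hw0 u
  have hp1 : p ≤ 1 := by rw [← hP.2]; exact sum_le_sum fun u _ => hwP u
  have hsB : s ≤ p * B := by
    rw [hs, hp, sum_mul]; exact sum_le_sum fun u _ => mul_le_mul_of_nonneg_left (hg u) (hw0 u)
  set a : U → ℝ := fun u => Fintype.card U * w u / L with ha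
  have ha0 : ∀ u, 0 ≤ a u := fun u => div_nonneg (mul_nonneg hc.le (hw0 u)) hL.le
  have ha1 : ∀ u, a u ≤ 1 := by
    intro u
    rw [ha, div_le_one hL]
    by_cases h1 : L < Fintype.card U * P u
    · simp [hw, ind_true h1, hL.le]
    · simpa [hw, ind_false h1] using not_lt.1 h1
  have has : 𝔼 u, a u * g u = s / L := by
    rw [Fintype.expect_eq_sum_div_card, hs, div_eq_div_iff hc.ne' hL.ne', sum_mul, sum_mul]
    refine sum_congr rfl fun u _ => ?_
    rw [ha]; field_simp
  have har : 𝔼 u, (1 - a u) = 1 - p / L := by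
    rw [Finset.expect_sub_distrib, Fintype.expect_const, Fintype.expect_eq_sum_div_card, hp]
    congr 1
    rw [div_eq_div_iff hc.ne' hL.ne', sum_mul, sum_mul]
    refine sum_congr rfl fun u _ => ?_
    rw [ha]; field_simp
  have hpL : p ≤ L := by
    have : 0 ≤ 𝔼 u, (1 - a u) := Finset.expect_nonneg fun u _ => by linarith [ha1 u]
    rw [har] at this
    exact (div_le_one hL).1 (by linarith)
  have hsum : ∑ u, P u * (g u + (B - g u) * ind (L < Fintype.card U * P u))
      = s + B * (1 - p) := by
    rw [hs, hp, ← hP.2, mul_sub, mul_sum, mul_sum, ← sum_sub_distrib, ← sum_add_distrib]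
    refine sum_congr rfl fun u _ => ?_
    rw [hw]; ring
  rw [hsum]
  have he := Real.exp_pos (-(M / L))
  rcases hp0.eq_or_lt with h0 | h0
  · have hs0 : s = 0 := by
      have := (sum_eq_zero_iff_of_nonneg fun u _ => hw0 u).1 h0.symm
      exact sum_eq_zero fun u hu => by rw [this u hu, zero_mul]
    have : 𝔼 C, h C ≤ B := Finset.expect_le univ_nonempty fun C _ => hhB C
    rw [hs0, ← h0]
    nlinarith [mul_nonneg hB he.le]
  · have h1 := covering_recursion (B := B) ha0 ha1 has har M h hhB hhg
    have h2 := one_sub_pow_le hp0 hp1 hL hpL M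
    set E := 𝔼 C, h C
    set t := (1 - p / L) ^ M
    have h3 : p * E ≤ s * (1 - t) + p * B * t := by
      have := mul_le_mul_of_nonneg_left h1 hL.le
      have e1 : L * ((1 - (1 - p / L)) * E) = p * E := by field_simp; ring
      have e2 : L * (s / L * (1 - t) + (1 - (1 - p / L)) * B * t) = s * (1 - t) + p * B * t := by
        field_simp; ring
      rwa [e1, e2] at this
    have hs0 : 0 ≤ s := sum_nonneg fun u _ => mul_nonneg (hw0 u) (hg0 u)
    have h4 : s * (1 - t) + p * B * t ≤ p * (s + B * (1 - p) + B * Real.exp (-(M / L)))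
        - s * Real.exp (-(M / L)) := by
      nlinarith [mul_le_mul_of_nonneg_left h2 (sub_nonneg.2 hsB)]
    refine le_of_mul_le_mul_left ?_ h0
    linarith [mul_nonneg hs0 he.le]

end Covering

theorem expect_bin_collision_le {U V K0 K1 : Type*} [Fintype U] [Fintype V] [Fintype K0]
    [Fintype K1] [Nonempty K0] [Nonempty K1] (u u' : U) (v v' : V) :
    𝔼 b0 : U → K0, 𝔼 b1 : U × V → K1, ind ((u', v') ≠ (u, v)) *
        (ind (b0 u' = b0 u) * ind (b1 (u', v') = b1 (u, v))) ≤
      1 / (Fintype.card K0 * Fintype.card K1) + ind (u' = u) * (1 / Fintype.card K1) := by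
  have hc0 : (0 : ℝ) ≤ 1 / (Fintype.card K0 * Fintype.card K1) := by positivity
  have hc1 : (0 : ℝ) ≤ 1 / Fintype.card K1 := by positivity
  by_cases hne : (u', v') ≠ (u, v)
  · have h1 : 𝔼 b1 : U × V → K1, ind (b1 (u', v') = b1 (u, v)) = 1 / Fintype.card K1 :=
      expect_collision hne
    simp_rw [ind_true hne, one_mul, ← Finset.mul_expect, h1, ← Finset.expect_mul]
    by_cases hu : u' = u
    · rw [ind_true hu, one_mul]
      have : 𝔼 b0 : U → K0, ind (b0 u' = b0 u) ≤ 1 :=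
        Finset.expect_le univ_nonempty fun _ _ => ind_le_one _
      linarith [mul_le_mul_of_nonneg_right this hc1]
    · have h0 : 𝔼 b0 : U → K0, ind (b0 u' = b0 u) = 1 / Fintype.card K0 := expect_collision hu
      rw [h0, ind_false hu, zero_mul, add_zero, one_div_mul_one_div]
  · simp_rw [ind_false hne, zero_mul]
    simp only [Finset.expect_const_zero]
    exact add_nonneg hc0 (mul_nonneg (ind_nonneg _) hc1)

section Decoding

variable {Y U V K0 K1 : Type*} [Nonempty V]

/-- The decoder that looks for a pair of codewords in the announced bins which is compatible with
the side information. -/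
def binDecoder (D0 : Finset U) (D1 : Finset V) (Good : U → V → Y → Prop) (b0 : U → K0)
    (b1 : U × V → K1) (k : K0 × K1) (y : Y) : V :=
  if h : ∃ p : U × V, p.1 ∈ D0 ∧ p.2 ∈ D1 ∧ b0 p.1 = k.1 ∧ b1 p = k.2 ∧ Good p.1 p.2 y
  then h.choose.2 else Classical.arbitrary V

theorem ind_binDecoder_le {D0 : Finset U} {D1 : Finset V} (Good : U → V → Y → Prop) (b0 : U → K0)
    (b1 : U × V → K1) (ok : V → Prop) {u : U} {v : V} (hu : u ∈ D0) (hv : v ∈ D1) (y : Y) :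
    ind (¬ok (binDecoder D0 D1 Good b0 b1 (b0 u, b1 (u, v)) y)) ≤
      ind (¬ok v ∨ ¬Good u v y) + ∑ u' ∈ D0, ∑ v' ∈ D1, ind ((u', v') ≠ (u, v)) *
        (ind (b0 u' = b0 u) * ind (b1 (u', v') = b1 (u, v))) * ind (Good u' v' y) := by
  have hnn : ∀ u' v', 0 ≤ ind ((u', v') ≠ (u, v)) *
      (ind (b0 u' = b0 u) * ind (b1 (u', v') = b1 (u, v))) * ind (Good u' v' y) := fun u' v' =>
    mul_nonneg (mul_nonneg (ind_nonneg _) (mul_nonneg (ind_nonneg _) (ind_nonneg _)))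
      (ind_nonneg _)
  have hS := sum_nonneg fun u' (_ : u' ∈ D0) => sum_nonneg fun v' (_ : v' ∈ D1) => hnn u' v'
  by_cases hbad : ¬ok v ∨ ¬Good u v y
  · rw [ind_true hbad]
    linarith [ind_le_one (¬ok (binDecoder D0 D1 Good b0 b1 (b0 u, b1 (u, v)) y))]
  push Not at hbad
  have hex : ∃ p : U × V, p.1 ∈ D0 ∧ p.2 ∈ D1 ∧ b0 p.1 = b0 u ∧ b1 p = b1 (u, v) ∧
      Good p.1 p.2 y := ⟨(u, v), hu, hv, rfl, rfl, hbad.2⟩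
  have hdec : binDecoder D0 D1 Good b0 b1 (b0 u, b1 (u, v)) y = hex.choose.2 := dif_pos hex
  obtain ⟨h1, h2, h3, h4, h5⟩ := hex.choose_spec
  rw [hdec]
  by_cases hp : hex.choose = (u, v)
  · rw [ind_false (not_not.2 (by rw [hp]; exact hbad.1))]
    exact add_nonneg (ind_nonneg _) hS
  · refine (ind_le_one _).trans (le_add_of_nonneg_of_le (ind_nonneg _) ?_)
    refine le_trans ?_ (single_le_sum (fun u' _ => sum_nonneg fun v' _ => hnn u' v') h1)
    refine le_trans ?_ (single_le_sum (fun v' _ => hnn hex.choose.1 v') h2)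
    rw [ind_true (show (hex.choose.1, hex.choose.2) ≠ (u, v) from hp), ind_true h3, ind_true h4,
      ind_true h5]
    norm_num

variable [Fintype U] [Fintype V] [Fintype K0] [Fintype K1] [Nonempty K0] [Nonempty K1]

theorem expect_binDecoder_le {D0 : Finset U} {D1 : Finset V} (Good : U → V → Y → Prop)
    (ok : V → Prop) {u : U} {v : V} (hu : u ∈ D0) (hv : v ∈ D1) (y : Y) :
    𝔼 b0 : U → K0, 𝔼 b1 : U × V → K1,
        ind (¬ok (binDecoder D0 D1 Good b0 b1 (b0 u, b1 (u, v)) y)) ≤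
      ind (¬ok v ∨ ¬Good u v y)
        + 1 / (Fintype.card K0 * Fintype.card K1) * ∑ u' ∈ D0, ∑ v' ∈ D1, ind (Good u' v' y)
        + 1 / Fintype.card K1 * ∑ v' ∈ D1, ind (Good u v' y) := by
  refine (Finset.expect_le_expect fun b0 _ => Finset.expect_le_expect fun b1 _ =>
    ind_binDecoder_le Good b0 b1 ok hu hv y).trans ?_
  simp_rw [Finset.expect_add_distrib, Fintype.expect_const, Finset.expect_sum_comm,
    ← Finset.expect_mul]
  rw [add_assoc]
  refine add_le_add_right ?_ _
  have hcol : ∀ u' v', (𝔼 b0 : U → K0, 𝔼 b1 : U × V → K1, ind ((u', v') ≠ (u, v)) *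
        (ind (b0 u' = b0 u) * ind (b1 (u', v') = b1 (u, v)))) * ind (Good u' v' y) ≤
      1 / (Fintype.card K0 * Fintype.card K1) * ind (Good u' v' y)
        + ind (u' = u) * (1 / Fintype.card K1 * ind (Good u v' y)) := by
    intro u' v'
    refine (mul_le_mul_of_nonneg_right (expect_bin_collision_le u u' v v')
      (ind_nonneg _)).trans (le_of_eq ?_)
    by_cases h : u' = u
    · subst h; ring
    · rw [ind_false h]; ring
  refine (sum_le_sum fun u' _ => sum_le_sum fun v' _ => hcol u' v').trans (le_of_eq ?_)
  simp_rw [sum_add_distrib, ← mul_sum]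
  rw [← sum_mul]
  congr 1
  have : ∑ u' ∈ D0, ind (u' = u) = 1 := by simp [ind, hu]
  rw [this, one_mul]

end Decoding

theorem expect_sum_codewords {V : Type*} [Fintype V] [Nonempty V] (M : ℕ) (F : V → ℝ) :
    𝔼 C : Fin M → V, ∑ m, F (C m) = M / Fintype.card V * ∑ v, F v := by
  rw [Finset.expect_sum_comm]
  simp_rw [expect_apply, Fintype.expect_eq_sum_div_card]
  rw [sum_const, card_univ, Fintype.card_fin, nsmul_eq_mul]
  ring

theorem sum_fiber_ind {S X : Type*} [Fintype S] [Fintype X] (xs : S → X) (F : S → X → ℝ) :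
    ∑ x, ∑ s, ind (xs s = x) * F s x = ∑ s, F s (xs s) := by
  rw [sum_comm]
  refine sum_congr rfl fun s _ => ?_
  simp [ind]

section OneShot

variable {S X Y U V : Type*} [Fintype S]

/-- Probability that the encoder observes `x`. -/
def srcMass (q : S → ℝ) (xs : S → X) (x : X) : ℝ := ∑ s, ind (xs s = x) * q s

/-- Probability that the encoder observes `x` and the codeword pair `(u, v)` is useless, either
because `v` is not an acceptable reconstruction or because the decoder would not recognize the
pair. -/
def missMass (q : S → ℝ) (xs : S → X) (ys : S → Y) (ok : S → V → Prop) (Good : U → V → Y → Prop)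
    (x : X) (u : U) (v : V) : ℝ :=
  ∑ s, ind (xs s = x) * (q s * ind (¬ok s v ∨ ¬Good u v (ys s)))

/-- Bound on the average of `missMass` for the best among `M` uniformly drawn codewords. -/
def coverCost [Fintype V] (q : S → ℝ) (xs : S → X) (ys : S → Y) (ok : S → V → Prop)
    (Good : U → V → Y → Prop) (P : X → U → V → ℝ) (L : ℝ) (M : ℕ) (x : X) (u : U) : ℝ :=
  ∑ v, P x u v * (missMass q xs ys ok Good x u v
    + (srcMass q xs x - missMass q xs ys ok Good x u v) * ind (L < Fintype.card V * P x u v))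
    + srcMass q xs x * Real.exp (-(M / L))

variable {q : S → ℝ} {xs : S → X} {ys : S → Y} {ok : S → V → Prop} {Good : U → V → Y → Prop}

theorem srcMass_nonneg (hq : ∀ s, 0 ≤ q s) (x : X) : 0 ≤ srcMass q xs x :=
  sum_nonneg fun s _ => mul_nonneg (ind_nonneg _) (hq s)

theorem sum_srcMass [Fintype X] : ∑ x, srcMass q xs x = ∑ s, q s :=
  sum_fiber_ind xs fun s _ => q s

theorem missMass_nonneg (hq : ∀ s, 0 ≤ q s) (x : X) (u : U) (v : V) :
    0 ≤ missMass q xs ys ok Good x u v :=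
  sum_nonneg fun s _ => mul_nonneg (ind_nonneg _) (mul_nonneg (hq s) (ind_nonneg _))

theorem missMass_le_srcMass (hq : ∀ s, 0 ≤ q s) (x : X) (u : U) (v : V) :
    missMass q xs ys ok Good x u v ≤ srcMass q xs x :=
  sum_le_sum fun s _ => mul_le_mul_of_nonneg_left
    (mul_le_of_le_one_right (hq s) (ind_le_one _)) (ind_nonneg _)

variable [Fintype V]

theorem coverCost_nonneg (hq : ∀ s, 0 ≤ q s) {P : X → U → V → ℝ} (hP : ∀ x u, IsPMF (P x u))
    (L : ℝ) (M : ℕ) (x : X) (u : U) : 0 ≤ coverCost q xs ys ok Good P L M x u :=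
  add_nonneg (sum_nonneg fun v _ => mul_nonneg ((hP x u).1 v)
    (add_nonneg (missMass_nonneg hq x u v)
      (mul_nonneg (sub_nonneg.2 (missMass_le_srcMass hq x u v)) (ind_nonneg _))))
    (mul_nonneg (srcMass_nonneg hq x) (Real.exp_pos _).le)

theorem coverCost_le (hq : ∀ s, 0 ≤ q s) {P : X → U → V → ℝ} (hP : ∀ x u, IsPMF (P x u))
    {L : ℝ} (hL : 0 < L) (M : ℕ) (x : X) (u : U) :
    coverCost q xs ys ok Good P L M x u ≤ 2 * srcMass q xs x := by
  have h1 : ∑ v, P x u v * (missMass q xs ys ok Good x u v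
      + (srcMass q xs x - missMass q xs ys ok Good x u v) * ind (L < Fintype.card V * P x u v))
      ≤ ∑ v, P x u v * srcMass q xs x := by
    refine sum_le_sum fun v _ => mul_le_mul_of_nonneg_left ?_ ((hP x u).1 v)
    have := mul_le_mul_of_nonneg_left (ind_le_one (L < Fintype.card V * P x u v))
      (sub_nonneg.2 (missMass_le_srcMass (xs := xs) (ys := ys) (ok := ok) (Good := Good) hq x u v))
    linarith
  rw [← sum_mul, (hP x u).2, one_mul] at h1
  have h2 : Real.exp (-(M / L)) ≤ 1 := Real.exp_le_one_iff.2 (by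
    have : 0 ≤ (M : ℝ) / L := by positivity
    linarith)
  have := mul_le_of_le_one_right (srcMass_nonneg (xs := xs) hq x) h2
  unfold coverCost
  linarith

variable [Fintype X] [Fintype U] {K0 K1 : Type*} [Fintype K0] [Fintype K1] [Nonempty K0]
  [Nonempty K1]

/-- For any first-layer codebook `C0` and selection `u` from it, there are a second-layer encoder
and a decoder for one receiver which work well on average over the binning `b0` of the first
layer. -/
theorem exists_receiver [Nonempty V] (hq : IsPMF q) {P : X → U → V → ℝ}
    (hP : ∀ x u, IsPMF (P x u)) {L a' : ℝ} (hL : 0 < L)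
    (ha' : ∀ u y, ∑ v, ind (Good u v y) ≤ a') {M0 M : ℕ} [NeZero M] (C0 : Fin M0 → U) {u : X → U}
    (hu : ∀ x, u x ∈ univ.image C0) :
    ∃ (k : (U → K0) → X → K1) (r : (U → K0) → K0 × K1 → Y → V),
      𝔼 b0 : U → K0, ∑ s, q s * ind (¬ok s (r b0 (b0 (u (xs s)), k b0 (xs s)) (ys s))) ≤
        ∑ x, coverCost q xs ys ok Good P L M x (u x)
        + M / (Fintype.card K0 * Fintype.card K1 * Fintype.card V)
          * ∑ m0, ∑ s, q s * ∑ v, ind (Good (C0 m0) v (ys s))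
        + M * a' / (Fintype.card K1 * Fintype.card V) := by
  have hmin : ∀ (C : Fin M → V) (x : X), ∃ m, ∀ m', missMass q xs ys ok Good x (u x) (C m) ≤
      missMass q xs ys ok Good x (u x) (C m') := fun C x => by
    obtain ⟨m, -, hm⟩ := exists_min_image univ
      (fun m => missMass q xs ys ok Good x (u x) (C m)) univ_nonempty
    exact ⟨m, fun m' => hm m' (mem_univ _)⟩
  choose sel hsel using hmin
  set T : (Fin M → V) → ℝ := fun C =>
    ∑ x, missMass q xs ys ok Good x (u x) (C (sel C x))
    + 1 / (Fintype.card K0 * Fintype.card K1) *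
      ∑ m0, ∑ s, q s * ∑ m, ind (Good (C0 m0) (C m) (ys s))
    + 1 / Fintype.card K1 * ∑ s, q s * ∑ m, ind (Good (u (xs s)) (C m) (ys s)) with hT
  have hET : 𝔼 C, T C ≤ ∑ x, coverCost q xs ys ok Good P L M x (u x)
        + M / (Fintype.card K0 * Fintype.card K1 * Fintype.card V)
          * ∑ m0, ∑ s, q s * ∑ v, ind (Good (C0 m0) v (ys s))
        + M * a' / (Fintype.card K1 * Fintype.card V) := by
    have hE : ∀ u s, 𝔼 C : Fin M → V, ∑ m, ind (Good u (C m) (ys s)) =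
        M / Fintype.card V * ∑ v, ind (Good u v (ys s)) := fun u s =>
      expect_sum_codewords M fun v => ind (Good u v (ys s))
    simp_rw [hT, Finset.expect_add_distrib, ← Finset.mul_expect, Finset.expect_sum_comm,
      ← Finset.mul_expect]
    simp_rw [← Finset.expect_sum_comm, hE]
    refine add_le_add (add_le_add ?_ (le_of_eq ?_)) ?_
    · rw [Finset.expect_sum_comm]
      refine sum_le_sum fun x _ => ?_
      exact covering (hP x (u x)) hL (srcMass_nonneg hq.1 x)
        (fun v => missMass_nonneg hq.1 x (u x) v) (fun v => missMass_le_srcMass hq.1 x (u x) v) M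
        (fun C => missMass_le_srcMass hq.1 x (u x) _) (fun C m => hsel C x m)
    · simp_rw [mul_left_comm (q _), ← mul_sum]
      ring
    · have : ∑ s, q s * (M / Fintype.card V * ∑ v, ind (Good (u (xs s)) v (ys s)))
          ≤ ∑ s, q s * (M / Fintype.card V * a') :=
        sum_le_sum fun s _ => mul_le_mul_of_nonneg_left
          (mul_le_mul_of_nonneg_left (ha' _ _) (by positivity)) (hq.1 s)
      rw [← sum_mul, hq.2, one_mul] at this
      refine (mul_le_mul_of_nonneg_left this (by positivity)).trans (le_of_eq ?_)
      ring
  obtain ⟨C, -, hC⟩ := Finset.exists_le_of_expect_le univ_nonempty hET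
  set v : X → V := fun x => C (sel C x) with hv
  set D0 := univ.image C0
  set D1 := univ.image C
  have hvD : ∀ x, v x ∈ D1 := fun x => mem_image_of_mem C (mem_univ _)
  set F : (U → K0) → (U × V → K1) → ℝ := fun b0 b1 => ∑ s, q s *
    ind (¬ok s (binDecoder D0 D1 Good b0 b1
      (b0 (u (xs s)), b1 (u (xs s), v (xs s))) (ys s))) with hF
  have hb1 : ∀ b0, ∃ b1, F b0 b1 ≤ 𝔼 b1, F b0 b1 := fun b0 => by
    obtain ⟨b1, -, h⟩ := Finset.exists_le_of_expect_le univ_nonempty (le_refl (𝔼 b1, F b0 b1))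
    exact ⟨b1, h⟩
  choose b1 hb1 using hb1
  refine ⟨fun b0 x => b1 b0 (u x, v x), fun b0 => binDecoder D0 D1 Good b0 (b1 b0),
    le_trans (Finset.expect_le_expect fun b0 _ => hb1 b0) (le_trans ?_ hC)⟩
  simp_rw [hF, Finset.expect_sum_comm, ← Finset.mul_expect]
  refine (sum_le_sum fun s _ => mul_le_mul_of_nonneg_left
    (expect_binDecoder_le Good (ok s) (hu (xs s)) (hvD (xs s)) (ys s)) (hq.1 s)).trans ?_
  simp_rw [hT, mul_add, sum_add_distrib]
  refine add_le_add (add_le_add (le_of_eq ?_) ?_) ?_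
  · exact (sum_fiber_ind xs fun s x => q s * ind (¬ok s (v x) ∨ ¬Good (u x) (v x) (ys s))).symm
  · rw [sum_comm, mul_sum]
    refine sum_le_sum fun s _ => ?_
    rw [← mul_sum, mul_left_comm]
    refine mul_le_mul_of_nonneg_left (mul_le_mul_of_nonneg_left ?_ (hq.1 s)) (by positivity)
    refine (sum_image_le_of_nonneg fun u' _ => sum_nonneg fun v' _ => ind_nonneg _).trans ?_
    exact sum_le_sum fun m _ => sum_image_le_of_nonneg fun v' _ => ind_nonneg _
  · rw [mul_sum]
    refine sum_le_sum fun s _ => ?_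
    rw [mul_left_comm]
    refine mul_le_mul_of_nonneg_left (mul_le_mul_of_nonneg_left ?_ (hq.1 s)) (by positivity)
    exact sum_image_le_of_nonneg fun v' _ => ind_nonneg _

end OneShot

section OneShot

variable {S X Y U V : Type*} [Fintype S] [Fintype X] [Fintype U] [Fintype V]
  {q : S → ℝ} {xs : S → X} {ys : S → Y} {ok : S → V → Prop} {Good : U → V → Y → Prop}

/-- Probability that one receiver fails under the ideal law, in which `(u, v)` is drawn from the
test channel. -/
def idealFail (q : S → ℝ) (xs : S → X) (ys : S → Y) (ok : S → V → Prop)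
    (Good : U → V → Y → Prop) (P0 : X → U → ℝ) (P : X → U → V → ℝ) (L : ℝ) : ℝ :=
  ∑ s, q s * ∑ u, P0 (xs s) u * ∑ v, P (xs s) u v *
    (ind (¬ok s v ∨ ¬Good u v (ys s)) + ind (L < Fintype.card V * P (xs s) u v))

theorem sum_coverCost_le (hq : IsPMF q) {P0 : X → U → ℝ} (hP0 : ∀ x, IsPMF (P0 x))
    {P : X → U → V → ℝ} (hP : ∀ x u, IsPMF (P x u)) (L : ℝ) (M : ℕ) :
    ∑ x, ∑ u, P0 x u * coverCost q xs ys ok Good P L M x u ≤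
      idealFail q xs ys ok Good P0 P L + Real.exp (-(M / L)) := by
  have h1 : ∀ x u, coverCost q xs ys ok Good P L M x u ≤
      ∑ s, ind (xs s = x) * (q s * ∑ v, P x u v *
        (ind (¬ok s v ∨ ¬Good u v (ys s)) + ind (L < Fintype.card V * P x u v)))
      + srcMass q xs x * Real.exp (-(M / L)) := by
    intro x u
    refine add_le_add_left ?_ _
    simp_rw [mul_sum]
    rw [sum_comm]
    refine sum_le_sum fun v _ => ?_
    have h : ∑ s, ind (xs s = x) * (q s * (P x u v *
        (ind (¬ok s v ∨ ¬Good u v (ys s)) + ind (L < Fintype.card V * P x u v)))) =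
        P x u v * (missMass q xs ys ok Good x u v
          + srcMass q xs x * ind (L < Fintype.card V * P x u v)) := by
      rw [missMass, srcMass, sum_mul, ← sum_add_distrib, mul_sum]
      exact sum_congr rfl fun s _ => by ring
    rw [h]
    refine mul_le_mul_of_nonneg_left ?_ ((hP x u).1 v)
    have := mul_nonneg (missMass_nonneg (xs := xs) (ys := ys) (ok := ok) (Good := Good) hq.1 x u v)
      (ind_nonneg (L < Fintype.card V * P x u v))
    linarith
  refine (sum_le_sum fun x _ => sum_le_sum fun u _ =>
    mul_le_mul_of_nonneg_left (h1 x u) ((hP0 x).1 u)).trans (le_of_eq ?_)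
  have h2 : ∀ (x : X) (A : U → ℝ) (B : ℝ),
      ∑ u, P0 x u * (A u + B) = ∑ u, P0 x u * A u + B := fun x A B => by
    simp_rw [mul_add]
    rw [sum_add_distrib, ← sum_mul, (hP0 x).2, one_mul]
  rw [sum_congr rfl fun x _ => h2 x _ _, sum_add_distrib, ← sum_mul, sum_srcMass, hq.2, one_mul,
    idealFail, ← sum_fiber_ind xs fun s x => q s * ∑ u, P0 x u * ∑ v, P x u v *
      (ind (¬ok s v ∨ ¬Good u v (ys s)) + ind (L < Fintype.card V * P x u v))]
  congr 1
  refine sum_congr rfl fun x _ => ?_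
  simp_rw [mul_sum]
  rw [sum_comm]
  refine sum_congr rfl fun s _ => sum_congr rfl fun u _ => sum_congr rfl fun v _ => ?_
  ring

variable {Y' V' : Type*} [Fintype V'] {ys' : S → Y'} {ok' : S → V' → Prop}
  {Good' : U → V' → Y' → Prop} {K0 K1 K2 : Type*} [Fintype K0] [Fintype K1] [Fintype K2]
  [Nonempty K0] [Nonempty K1] [Nonempty K2]

/-- One-shot achievability for the Gray–Wyner network with side information at the receivers. -/
theorem exists_code [Nonempty U] [Nonempty V] [Nonempty V'] (hq : IsPMF q) {P0 : X → U → ℝ}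
    (hP0 : ∀ x, IsPMF (P0 x)) {P : X → U → V → ℝ} (hP : ∀ x u, IsPMF (P x u))
    {P' : X → U → V' → ℝ} (hP' : ∀ x u, IsPMF (P' x u))
    {L0 L L' : ℝ} (hL0 : 0 < L0) (hL : 0 < L) (hL' : 0 < L') {a1 a0 a1' a0' : ℝ}
    (ha1 : ∀ u y, ∑ v, ind (Good u v y) ≤ a1) (ha0 : ∀ y, ∑ u, ∑ v, ind (Good u v y) ≤ a0)
    (ha1' : ∀ u y, ∑ v, ind (Good' u v y) ≤ a1') (ha0' : ∀ y, ∑ u, ∑ v, ind (Good' u v y) ≤ a0')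
    (M0 M M' : ℕ) [NeZero M0] [NeZero M] [NeZero M'] :
    ∃ (enc : X → K0 × K1 × K2) (r1 : K0 × K1 → Y → V) (r2 : K0 × K2 → Y' → V'),
      ∑ s, q s * ind (¬ok s (r1 ((enc (xs s)).1, (enc (xs s)).2.1) (ys s)))
        + ∑ s, q s * ind (¬ok' s (r2 ((enc (xs s)).1, (enc (xs s)).2.2) (ys' s))) ≤
      (idealFail q xs ys ok Good P0 P L + idealFail q xs ys' ok' Good' P0 P' L'
        + 4 * ∑ s, q s * ∑ u, P0 (xs s) u * ind (L0 < Fintype.card U * P0 (xs s) u))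
      + (Real.exp (-(M / L)) + Real.exp (-(M' / L')) + 4 * Real.exp (-(M0 / L0)))
      + (M0 * M * a0 / (Fintype.card K0 * Fintype.card K1 * Fintype.card U * Fintype.card V)
        + M * a1 / (Fintype.card K1 * Fintype.card V))
      + (M0 * M' * a0' / (Fintype.card K0 * Fintype.card K2 * Fintype.card U * Fintype.card V')
        + M' * a1' / (Fintype.card K2 * Fintype.card V')) := by
  set c : X → U → ℝ := fun x u => coverCost q xs ys ok Good P L M x u
    + coverCost q xs ys' ok' Good' P' L' M' x u with hc
  have hc0 : ∀ x u, 0 ≤ c x u := fun x u =>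
    add_nonneg (coverCost_nonneg hq.1 hP L M x u) (coverCost_nonneg hq.1 hP' L' M' x u)
  have hc4 : ∀ x u, c x u ≤ 4 * srcMass q xs x := fun x u => by
    have h1 := coverCost_le (xs := xs) (ys := ys) (ok := ok) (Good := Good) hq.1 hP hL M x u
    have h2 := coverCost_le (xs := xs) (ys := ys') (ok := ok') (Good := Good') hq.1 hP' hL' M' x u
    simp only [hc]; linarith
  have hmin : ∀ (C : Fin M0 → U) (x : X), ∃ m, ∀ m', c x (C m) ≤ c x (C m') := fun C x => by
    obtain ⟨m, -, hm⟩ := exists_min_image univ (fun m => c x (C m)) univ_nonempty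
    exact ⟨m, fun m' => hm m' (mem_univ _)⟩
  choose sel hsel using hmin
  set A : ℝ := M / (Fintype.card K0 * Fintype.card K1 * Fintype.card V) with hA
  set A' : ℝ := M' / (Fintype.card K0 * Fintype.card K2 * Fintype.card V') with hA'
  set G : U → ℝ := fun u => ∑ s, q s * ∑ v, ind (Good u v (ys s)) with hG
  set G' : U → ℝ := fun u => ∑ s, q s * ∑ v, ind (Good' u v (ys' s)) with hG'
  have hGa : ∑ u, G u ≤ a0 := by
    rw [hG, sum_comm]
    simp_rw [← mul_sum]
    refine (sum_le_sum fun s _ => mul_le_mul_of_nonneg_left (ha0 (ys s)) (hq.1 s)).trans ?_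
    rw [← sum_mul, hq.2, one_mul]
  have hGa' : ∑ u, G' u ≤ a0' := by
    rw [hG', sum_comm]
    simp_rw [← mul_sum]
    refine (sum_le_sum fun s _ => mul_le_mul_of_nonneg_left (ha0' (ys' s)) (hq.1 s)).trans ?_
    rw [← sum_mul, hq.2, one_mul]
  set T : (Fin M0 → U) → ℝ := fun C =>
    ∑ x, c x (C (sel C x)) + A * ∑ m, G (C m) + A' * ∑ m, G' (C m) with hT
  have hET : 𝔼 C, T C ≤ (∑ x, ∑ u, P0 x u * c x u
      + 4 * ∑ s, q s * ∑ u, P0 (xs s) u * ind (L0 < Fintype.card U * P0 (xs s) u)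
      + 4 * Real.exp (-(M0 / L0))) + A * (M0 / Fintype.card U * a0)
      + A' * (M0 / Fintype.card U * a0') := by
    simp_rw [hT, Finset.expect_add_distrib, ← Finset.mul_expect, expect_sum_codewords]
    refine add_le_add (add_le_add ?_ ?_) ?_
    · rw [Finset.expect_sum_comm]
      have h1 : ∀ x, 𝔼 C : Fin M0 → U, c x (C (sel C x)) ≤
          ∑ u, P0 x u * c x u + 4 * (srcMass q xs x
            * ∑ u, P0 x u * ind (L0 < Fintype.card U * P0 x u))
          + srcMass q xs x * (4 * Real.exp (-(M0 / L0))) := by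
        intro x
        refine (covering (hP0 x) hL0 (mul_nonneg (by norm_num) (srcMass_nonneg hq.1 x))
          (hc0 x) (hc4 x) M0 (fun C => hc4 x _) (fun C m => hsel C x m)).trans ?_
        refine add_le_add ?_ (le_of_eq (by ring))
        rw [mul_sum, mul_sum, ← sum_add_distrib]
        refine sum_le_sum fun u _ => ?_
        have := mul_nonneg ((hP0 x).1 u)
          (mul_nonneg (hc0 x u) (ind_nonneg (L0 < Fintype.card U * P0 x u)))
        linarith
      refine (sum_le_sum fun x _ => h1 x).trans (le_of_eq ?_)
      rw [sum_add_distrib, sum_add_distrib, ← sum_mul, sum_srcMass, hq.2, one_mul, ← mul_sum]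
      congr 3
      rw [← sum_fiber_ind xs fun s x => q s * ∑ u, P0 x u * ind (L0 < Fintype.card U * P0 x u)]
      refine sum_congr rfl fun x _ => ?_
      rw [srcMass, sum_mul]
      exact sum_congr rfl fun s _ => by ring
    · exact mul_le_mul_of_nonneg_left (mul_le_mul_of_nonneg_left hGa (by positivity))
        (by positivity)
    · exact mul_le_mul_of_nonneg_left (mul_le_mul_of_nonneg_left hGa' (by positivity))
        (by positivity)
  obtain ⟨C0, -, hC0⟩ := Finset.exists_le_of_expect_le univ_nonempty hET
  set u : X → U := fun x => C0 (sel C0 x) with hu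
  have huC : ∀ x, u x ∈ univ.image C0 := fun x => mem_image_of_mem C0 (mem_univ _)
  obtain ⟨k, r, hr⟩ := exists_receiver (K0 := K0) (K1 := K1) (xs := xs) (ys := ys) (ok := ok)
    hq hP hL ha1 (M := M) C0 huC
  obtain ⟨k', r', hr'⟩ := exists_receiver (K0 := K0) (K1 := K2) (xs := xs) (ys := ys') (ok := ok')
    hq hP' hL' ha1' (M := M') C0 huC
  have hsum := add_le_add hr hr'
  rw [← Finset.expect_add_distrib] at hsum
  obtain ⟨b0, -, hb0⟩ := Finset.exists_le_of_expect_le univ_nonempty hsum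
  refine ⟨fun x => (b0 (u x), k b0 x, k' b0 x), r b0, r' b0, hb0.trans ?_⟩
  have hcost : ∑ x, ∑ u, P0 x u * c x u ≤
      idealFail q xs ys ok Good P0 P L + Real.exp (-(M / L))
      + (idealFail q xs ys' ok' Good' P0 P' L' + Real.exp (-(M' / L'))) := by
    refine le_trans (le_of_eq ?_) (add_le_add (sum_coverCost_le hq hP0 hP L M)
      (sum_coverCost_le hq hP0 hP' L' M'))
    simp_rw [hc, mul_add, sum_add_distrib]
  have hTC : T C0 = ∑ x, coverCost q xs ys ok Good P L M x (u x)
      + ∑ x, coverCost q xs ys' ok' Good' P' L' M' x (u x)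
      + A * ∑ m, G (C0 m) + A' * ∑ m, G' (C0 m) := by
    simp only [hT, hc, sum_add_distrib, hu]
  have e1 : A * (M0 / Fintype.card U * a0) = M0 * M * a0 /
      (Fintype.card K0 * Fintype.card K1 * Fintype.card U * Fintype.card V) := by
    rw [hA]; field_simp
  have e2 : A' * (M0 / Fintype.card U * a0') = M0 * M' * a0' /
      (Fintype.card K0 * Fintype.card K2 * Fintype.card U * Fintype.card V') := by
    rw [hA']; field_simp
  rw [e1, e2] at hC0
  linarith

end OneShot

section LLN

variable {Z : Type*} [Fintype Z] {μ : Z → ℝ}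

theorem sum_fin_succ {n : ℕ} (F : (Fin (n + 1) → Z) → ℝ) :
    ∑ z, F z = ∑ a, ∑ z : Fin n → Z, F (Fin.cons a z) := by
  rw [← (Fin.consEquiv fun _ => Z).sum_comp, Fintype.sum_prod_type]
  rfl

theorem isPMF_pi {n : ℕ} {K : Fin n → Z → ℝ} (hK : ∀ t, IsPMF (K t)) :
    IsPMF fun z : Fin n → Z => ∏ t, K t (z t) := by
  refine ⟨fun z => prod_nonneg fun t _ => (hK t).1 _, ?_⟩
  rw [← Fintype.piFinset_univ, ← prod_univ_sum]
  exact prod_eq_one fun t _ => (hK t).2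

theorem isPMF_prod (hμ : IsPMF μ) (n : ℕ) : IsPMF fun z : Fin n → Z => ∏ t, μ (z t) :=
  isPMF_pi fun _ => hμ

theorem sum_prod_mul_sum (hμ : IsPMF μ) {h : Z → ℝ} (hh : ∑ z, μ z * h z = 0) (n : ℕ) :
    ∑ z : Fin n → Z, (∏ t, μ (z t)) * ∑ t, h (z t) = 0 := by
  induction n with
  | zero => simp
  | succ n ih =>
    rw [sum_fin_succ]
    have : ∀ a, ∑ z : Fin n → Z, (∏ t, μ ((Fin.cons a z : Fin (n + 1) → Z) t)) *
        ∑ t, h ((Fin.cons a z : Fin (n + 1) → Z) t) = μ a * h a := by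
      intro a
      simp_rw [Fin.prod_univ_succ, Fin.sum_univ_succ, Fin.cons_zero, Fin.cons_succ, mul_assoc]
      rw [← mul_sum]
      simp_rw [mul_add]
      rw [sum_add_distrib, ih, ← sum_mul, (isPMF_prod hμ n).2, one_mul, add_zero]
    rw [sum_congr rfl fun a _ => this a, hh]

theorem sum_prod_mul_sq (hμ : IsPMF μ) {h : Z → ℝ} (hh : ∑ z, μ z * h z = 0) (n : ℕ) :
    ∑ z : Fin n → Z, (∏ t, μ (z t)) * (∑ t, h (z t)) ^ 2 = n * ∑ z, μ z * h z ^ 2 := by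
  induction n with
  | zero => simp
  | succ n ih =>
    rw [sum_fin_succ]
    have : ∀ a, ∑ z : Fin n → Z, (∏ t, μ ((Fin.cons a z : Fin (n + 1) → Z) t)) *
        (∑ t, h ((Fin.cons a z : Fin (n + 1) → Z) t)) ^ 2 =
        μ a * h a ^ 2 + μ a * (n * ∑ z, μ z * h z ^ 2) := by
      intro a
      simp_rw [Fin.prod_univ_succ, Fin.sum_univ_succ, Fin.cons_zero, Fin.cons_succ, mul_assoc]
      rw [← mul_sum, ← mul_add]
      congr 1
      calc _ = ∑ z : Fin n → Z, ((∏ t, μ (z t)) * h a ^ 2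
            + ((∏ t, μ (z t)) * ∑ t, h (z t)) * (2 * h a)
            + (∏ t, μ (z t)) * (∑ t, h (z t)) ^ 2) := sum_congr rfl fun z _ => by ring
        _ = _ := by
          rw [sum_add_distrib, sum_add_distrib, ← sum_mul, ← sum_mul, ih,
            sum_prod_mul_sum hμ hh, (isPMF_prod hμ n).2]
          ring
    rw [sum_congr rfl fun a _ => this a, sum_add_distrib, ← sum_mul, hμ.2]
    push_cast
    ring

/-- Weak law of large numbers for a finite-alphabet memoryless source (upper deviations). -/
theorem tendsto_upper_deviation (hμ : IsPMF μ) (f : Z → ℝ) {δ : ℝ} (hδ : 0 < δ) :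
    Filter.Tendsto (fun n : ℕ => ∑ z : Fin n → Z, (∏ t, μ (z t)) *
      ind (n * (∑ a, μ a * f a + δ) < ∑ t, f (z t))) Filter.atTop (nhds 0) := by
  set m := ∑ a, μ a * f a with hm
  have hh : ∑ z, μ z * (f z - m) = 0 := by
    simp_rw [mul_sub]
    rw [sum_sub_distrib, ← sum_mul, hμ.2, one_mul, sub_self]
  have hlim : Filter.Tendsto (fun n : ℕ => (∑ z, μ z * (f z - m) ^ 2) / δ ^ 2 / (n : ℝ))
      Filter.atTop (nhds 0) := tendsto_const_div_atTop_nhds_zero_nat _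
  refine squeeze_zero' (Filter.Eventually.of_forall fun n => sum_nonneg fun z _ =>
    mul_nonneg ((isPMF_prod hμ n).1 z) (ind_nonneg _)) ?_ hlim
  filter_upwards [Filter.eventually_gt_atTop 0] with n hn
  have hn' : (0 : ℝ) < n := by exact_mod_cast hn
  have hb : ∀ z : Fin n → Z, ind (n * (m + δ) < ∑ t, f (z t)) ≤
      (∑ t, (f (z t) - m)) ^ 2 * (1 / (n * δ) ^ 2) := by
    intro z
    by_cases h : n * (m + δ) < ∑ t, f (z t)
    · rw [ind_true h, mul_one_div, one_le_div (by positivity), sum_sub_distrib]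
      simp only [sum_const, card_univ, Fintype.card_fin, nsmul_eq_mul]
      exact pow_le_pow_left₀ (by positivity) (by linarith) 2
    · rw [ind_false h]; positivity
  refine (sum_le_sum fun z _ => mul_le_mul_of_nonneg_left (hb z)
    ((isPMF_prod hμ n).1 z)).trans (le_of_eq ?_)
  simp_rw [← mul_assoc]
  rw [← sum_mul, sum_prod_mul_sq hμ hh]
  field_simp

theorem freqOf_eq {A : Type*} {n : ℕ} (x : Fin n → A) (a : A) :
    freqOf x a = (∑ t, ind (x t = a)) / n := by
  simp [freqOf, ind]

/-- The image of a memoryless source under a letter map is typical with high probability. -/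
theorem tendsto_not_typical {A : Type*} [Fintype A] (hμ : IsPMF μ) (g : Z → A) {P : A → ℝ}
    (hP : ∀ a, P a = ∑ z, μ z * ind (g z = a)) {ε : ℝ} (hε : 0 < ε) :
    Filter.Tendsto (fun n : ℕ => ∑ z : Fin n → Z, (∏ t, μ (z t)) *
      ind (¬Typical ε P fun t => g (z t))) Filter.atTop (nhds 0) := by
  have hP0 : ∀ a, 0 ≤ P a := fun a => by
    rw [hP]; exact sum_nonneg fun z _ => mul_nonneg (hμ.1 z) (ind_nonneg _)
  set E : A → ℕ → ℝ := fun a n => ∑ z : Fin n → Z, (∏ t, μ (z t)) *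
    ind (¬|freqOf (fun t => g (z t)) a - P a| ≤ ε * P a) with hE
  have hE0 : ∀ a, Filter.Tendsto (E a) Filter.atTop (nhds 0) := by
    intro a
    rcases (hP0 a).eq_or_lt with h0 | h0
    · refine tendsto_const_nhds.congr fun n => (sum_eq_zero fun z _ => ?_).symm
      by_cases h : ∃ t, g (z t) = a
      · obtain ⟨t, ht⟩ := h
        have h1 : μ (z t) = 0 := by
          have := (sum_eq_zero_iff_of_nonneg fun z _ => mul_nonneg (hμ.1 z)
            (ind_nonneg (g z = a))).1 ((hP a).symm.trans h0.symm) (z t) (mem_univ _)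
          rwa [ind_true ht, mul_one] at this
        rw [prod_eq_zero (mem_univ t) h1, zero_mul]
      · push Not at h
        rw [ind_false, mul_zero]
        rw [not_not, freqOf_eq, sum_eq_zero fun t _ => ind_false (h t), ← h0]
        simp
    · have h1 := tendsto_upper_deviation hμ (fun z => ind (g z = a)) (mul_pos hε h0)
      have h2 := tendsto_upper_deviation hμ (fun z => -ind (g z = a)) (mul_pos hε h0)
      have h3 := h1.add h2
      rw [add_zero] at h3
      refine squeeze_zero' (Filter.Eventually.of_forall fun n => sum_nonneg fun z _ =>
        mul_nonneg ((isPMF_prod hμ n).1 z) (ind_nonneg _)) ?_ h3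
      filter_upwards [Filter.eventually_gt_atTop 0] with n hn
      have hn' : (0 : ℝ) < n := by exact_mod_cast hn
      rw [← sum_add_distrib]
      refine sum_le_sum fun z _ => ?_
      rw [← mul_add]
      refine mul_le_mul_of_nonneg_left ?_ ((isPMF_prod hμ n).1 z)
      refine le_trans (ind_mono ?_) (ind_or_le _ _)
      intro h
      simp only [mul_neg, sum_neg_distrib]
      rw [← hP a]
      by_contra hc
      push Not at hc
      apply h
      rw [freqOf_eq, abs_le]
      constructor
      · rw [neg_le_sub_iff_le_add, ← sub_le_iff_le_add, le_div_iff₀ hn']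
        linarith [hc.2]
      · rw [sub_le_iff_le_add, div_le_iff₀ hn']
        linarith [hc.1]
  have hsum : Filter.Tendsto (fun n => ∑ a, E a n) Filter.atTop (nhds 0) := by
    simpa using tendsto_finsetSum univ fun a _ => hE0 a
  refine squeeze_zero (fun n => sum_nonneg fun z _ =>
    mul_nonneg ((isPMF_prod hμ n).1 z) (ind_nonneg _)) (fun n => ?_) hsum
  simp only [hE]
  rw [sum_comm]
  refine sum_le_sum fun z _ => ?_
  rw [← mul_sum]
  refine mul_le_mul_of_nonneg_left ?_ ((isPMF_prod hμ n).1 z)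
  by_cases h : Typical ε P fun t => g (z t)
  · rw [ind_false (not_not.2 h)]
    exact sum_nonneg fun a _ => ind_nonneg _
  · obtain ⟨a, ha⟩ := not_forall.1 h
    rw [ind_true h, ← ind_true ha]
    exact single_le_sum (f := fun a => ind (¬|freqOf (fun t => g (z t)) a - P a| ≤ ε * P a))
      (fun a _ => ind_nonneg _) (mem_univ a)

end LLN

section Entropy

variable {Ω Z A B : Type*} [Fintype Ω]

theorem distOf_eq (w : Ω → ℝ) (F : Ω → A) (a : A) :
    distOf w F a = ∑ ω, ind (F ω = a) * w ω := by
  simp [distOf, prOf, ind]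

theorem le_distOf {w : Ω → ℝ} (hw : ∀ ω, 0 ≤ w ω) (F : Ω → A) (ω : Ω) :
    w ω ≤ distOf w F (F ω) := by
  rw [distOf_eq]
  have := single_le_sum (f := fun ω' => ind (F ω' = F ω) * w ω')
    (fun ω' _ => mul_nonneg (ind_nonneg _) (hw ω')) (mem_univ ω)
  simpa [ind_true] using this

theorem distOf_nonneg {w : Ω → ℝ} (hw : ∀ ω, 0 ≤ w ω) (F : Ω → A) (a : A) : 0 ≤ distOf w F a := by
  rw [distOf_eq]; exact sum_nonneg fun ω _ => mul_nonneg (ind_nonneg _) (hw ω)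

theorem distOf_distOf [Fintype Z] (w : Ω → ℝ) (π : Ω → Z) (F : Z → A) (a : A) :
    distOf (distOf w π) F a = distOf w (fun ω => F (π ω)) a := by
  simp_rw [distOf_eq]
  rw [← sum_fiber_ind π fun ω z => ind (F z = a) * w ω]
  simp_rw [mul_sum]
  exact sum_congr rfl fun z _ => sum_congr rfl fun ω _ => by ring

/-- The conditional distribution of `F` given `G`. -/
def condDist (w : Ω → ℝ) (F : Ω → A) (G : Ω → B) (a : A) (b : B) : ℝ :=
  distOf w (fun ω => (F ω, G ω)) (a, b) / distOf w G b

theorem condDist_nonneg {w : Ω → ℝ} (hw : ∀ ω, 0 ≤ w ω) (F : Ω → A) (G : Ω → B) (a : A) (b : B) :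
    0 ≤ condDist w F G a b :=
  div_nonneg (distOf_nonneg hw _ _) (distOf_nonneg hw _ _)

theorem condDist_pos {w : Ω → ℝ} (hw : ∀ ω, 0 ≤ w ω) (F : Ω → A) (G : Ω → B) {ω : Ω}
    (hω : 0 < w ω) : 0 < condDist w F G (F ω) (G ω) :=
  div_pos (hω.trans_le (le_distOf hw (fun ω => (F ω, G ω)) ω)) (hω.trans_le (le_distOf hw G ω))

variable [Fintype A]

theorem sum_distOf_prod (w : Ω → ℝ) (F : Ω → A) (G : Ω → B) (b : B) :
    ∑ a, distOf w (fun ω => (F ω, G ω)) (a, b) = distOf w G b := by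
  simp_rw [distOf_eq]
  rw [← sum_fiber_ind F fun ω _ => ind (G ω = b) * w ω]
  refine sum_congr rfl fun a _ => sum_congr rfl fun ω _ => ?_
  rw [← mul_assoc]
  congr 1
  simp only [ind, Prod.mk.injEq]
  by_cases h1 : F ω = a <;> by_cases h2 : G ω = b <;> simp [h1, h2]

theorem sum_condDist_le (w : Ω → ℝ) (F : Ω → A) (G : Ω → B) (b : B) :
    ∑ a, condDist w F G a b ≤ 1 := by
  simp_rw [condDist]
  rw [← sum_div, sum_distOf_prod]
  exact div_self_le_one _

variable [Fintype B]

theorem entOf_eq (w : Ω → ℝ) (F : Ω → A) :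
    entOf w F = -∑ ω, w ω * Real.logb 2 (distOf w F (F ω)) := by
  rw [entOf, ← sum_fiber_ind F fun ω a => w ω * Real.logb 2 (distOf w F a)]
  congr 1
  refine sum_congr rfl fun a _ => ?_
  rw [distOf_eq, sum_mul]
  exact sum_congr rfl fun ω _ => mul_assoc _ _ _

theorem entOf_distOf [Fintype Z] (w : Ω → ℝ) (π : Ω → Z) (F : Z → A) :
    entOf (distOf w π) F = entOf w fun ω => F (π ω) := by
  simp_rw [entOf, distOf_distOf]

theorem entOf_sub_entOf {w : Ω → ℝ} (hw : ∀ ω, 0 ≤ w ω) (F : Ω → A) (G : Ω → B)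
    {c : Ω → ℝ} (hc : ∀ ω, 0 < w ω → distOf w F (F ω) = c ω * distOf w G (G ω)) :
    entOf w F - entOf w G = -∑ ω, w ω * Real.logb 2 (c ω) := by
  rw [entOf_eq, entOf_eq, neg_sub_neg, ← neg_sub, neg_inj, ← sum_sub_distrib]
  refine sum_congr rfl fun ω _ => ?_
  rcases (hw ω).eq_or_lt with h | h
  · simp [← h]
  · have h1 := h.trans_le (le_distOf hw F ω)
    have h2 := h.trans_le (le_distOf hw G ω)
    rw [hc ω h] at h1 ⊢
    rw [Real.logb_mul (left_ne_zero_of_mul h1.ne') h2.ne']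
    ring

theorem entOf_prod_sub_entOf {w : Ω → ℝ} (hw : ∀ ω, 0 ≤ w ω) (F : Ω → A) (G : Ω → B) :
    entOf w (fun ω => (F ω, G ω)) - entOf w G =
      -∑ ω, w ω * Real.logb 2 (condDist w F G (F ω) (G ω)) :=
  entOf_sub_entOf hw _ G fun ω hω => by
    rw [condDist, div_mul_cancel₀ _ (hω.trans_le (le_distOf hw G ω)).ne']

theorem sum_mul_logb_ge {p : A → ℝ} (hp : IsPMF p) :
    -Real.logb 2 (Fintype.card A) ≤ ∑ a, p a * Real.logb 2 (p a) := by
  have hA : (0 : ℝ) < Fintype.card A := by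
    have : Nonempty A := by
      by_contra h
      rw [not_nonempty_iff] at h
      simpa using hp.2
    exact_mod_cast Fintype.card_pos
  have h2 : (0 : ℝ) < Real.log 2 := Real.log_pos one_lt_two
  have key : ∀ a, p a * -Real.log (Fintype.card A) - p a * Real.log (p a) ≤
      1 / Fintype.card A - p a := by
    intro a
    rcases (hp.1 a).eq_or_lt with h | h
    · rw [← h]; simp
    · have h3 := Real.log_le_sub_one_of_pos (x := 1 / (Fintype.card A * p a)) (by positivity)
      rw [one_div, Real.log_inv, Real.log_mul hA.ne' h.ne'] at h3
      have h4 := mul_le_mul_of_nonneg_left h3 h.le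
      have h5 : p a * ((Fintype.card A * p a)⁻¹ - 1) = 1 / Fintype.card A - p a := by
        field_simp
      linarith
  have h6 := sum_le_sum fun a (_ : a ∈ univ) => key a
  rw [sum_sub_distrib, sum_sub_distrib, ← sum_mul, hp.2, sum_const, card_univ, nsmul_eq_mul,
    mul_one_div_cancel hA.ne'] at h6
  simp_rw [Real.logb, ← mul_div_assoc]
  rw [← sum_div, ← neg_div]
  exact div_le_div_of_nonneg_right (by linarith) h2.le

end Entropy

theorem exists_disintegration {U V : Type*} [Fintype V] [Nonempty V] {J : U → V → ℝ}
    (hJ : ∀ u v, 0 ≤ J u v) :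
    ∃ P : U → V → ℝ, (∀ u, IsPMF (P u)) ∧ ∀ u v, (∑ v', J u v') * P u v = J u v := by
  refine ⟨fun u v => if ∑ v', J u v' = 0 then 1 / Fintype.card V else J u v / ∑ v', J u v',
    fun u => ?_, fun u v => ?_⟩
  · by_cases h : ∑ v', J u v' = 0
    · simp only [h, if_true]
      exact ⟨fun v => by positivity, by simp⟩
    · simp only [h, if_false]
      exact ⟨fun v => div_nonneg (hJ u v) (sum_nonneg fun v _ => hJ u v),
        by rw [← sum_div, div_self h]⟩
  · by_cases h : ∑ v', J u v' = 0
    · rw [h, zero_mul, (sum_eq_zero_iff_of_nonneg fun v _ => hJ u v).1 h v (mem_univ v)]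
    · simp only [h, if_false]; field_simp

section TestChannel

variable {S X Y U V : Type*} [Fintype S] [Fintype U] [Fintype V]

/-- Joint law of the source with the auxiliary variables drawn from the test channel. -/
def jointLaw (q : S → ℝ) (xs : S → X) (P0 : X → U → ℝ) (P : X → U → V → ℝ) (z : S × U × V) : ℝ :=
  q z.1 * (P0 (xs z.1) z.2.1 * P (xs z.1) z.2.1 z.2.2)

variable {q : S → ℝ} {xs : S → X} {ys : S → Y} {P0 : X → U → ℝ} {P : X → U → V → ℝ}

theorem sum_jointLaw_mul (F : S × U × V → ℝ) :
    ∑ z, jointLaw q xs P0 P z * F z =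
      ∑ s, q s * ∑ u, P0 (xs s) u * ∑ v, P (xs s) u v * F (s, u, v) := by
  simp_rw [Fintype.sum_prod_type, mul_sum, jointLaw]
  exact sum_congr rfl fun s _ => sum_congr rfl fun u _ => sum_congr rfl fun v _ => by ring

theorem isPMF_jointLaw (hq : IsPMF q) (hP0 : ∀ x, IsPMF (P0 x)) (hP : ∀ x u, IsPMF (P x u)) :
    IsPMF (jointLaw q xs P0 P) := by
  refine ⟨fun z => mul_nonneg (hq.1 _) (mul_nonneg ((hP0 _).1 _) ((hP _ _).1 _)), ?_⟩
  have := sum_jointLaw_mul (q := q) (xs := xs) (P0 := P0) (P := P) fun _ => 1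
  simpa [(hP _ _).2, (hP0 _).2, hq.2] using this

theorem distOf_jointLaw_all (x : X) (y : Y) (u : U) (v : V) :
    distOf (jointLaw q xs P0 P) (fun z => (xs z.1, (z.2.1, z.2.2), ys z.1)) (x, (u, v), y) =
      (P0 x u * P x u v) * distOf q (fun s => (xs s, ys s)) (x, y) := by
  simp_rw [distOf_eq, mul_comm (ind _) (jointLaw q xs P0 P _)]
  rw [sum_jointLaw_mul, mul_sum]
  refine sum_congr rfl fun s _ => ?_
  by_cases h : (xs s, ys s) = (x, y)
  · obtain ⟨rfl, rfl⟩ := Prod.mk.inj h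
    rw [Finset.sum_eq_single u, Finset.sum_eq_single v]
    · simp [ind]; ring
    · intro v' _ hv; simp [ind, hv]
    · simp
    · intro u' _ hu; simp [ind, hu]
    · simp
  · rw [ind_false h, zero_mul, mul_zero]
    refine mul_eq_zero_of_right _ (sum_eq_zero fun u' _ => mul_eq_zero_of_right _
      (sum_eq_zero fun v' _ => mul_eq_zero_of_right _ (ind_false fun h' => h ?_)))
    simp only [Prod.mk.injEq] at h' ⊢
    exact ⟨h'.1, h'.2.2⟩

theorem distOf_jointLaw_source_aux (hP : ∀ x u, IsPMF (P x u)) (x : X) (y : Y) (u : U) :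
    distOf (jointLaw q xs P0 P) (fun z => (xs z.1, (z.2.1, ys z.1))) (x, (u, y)) =
      P0 x u * distOf q (fun s => (xs s, ys s)) (x, y) := by
  simp_rw [distOf_eq, mul_comm (ind _) (jointLaw q xs P0 P _)]
  rw [sum_jointLaw_mul, mul_sum]
  simp_rw [← sum_mul, (hP _ _).2, one_mul]
  refine sum_congr rfl fun s _ => ?_
  by_cases h : (xs s, ys s) = (x, y)
  · obtain ⟨rfl, rfl⟩ := Prod.mk.inj h
    rw [Finset.sum_eq_single u]
    · simp [ind]; ring
    · intro u' _ hu; simp [ind, hu]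
    · simp
  · rw [ind_false h, zero_mul, mul_zero]
    refine mul_eq_zero_of_right _ (sum_eq_zero fun u' _ => mul_eq_zero_of_right _
      (ind_false fun h' => h ?_))
    simp only [Prod.mk.injEq] at h' ⊢
    exact ⟨h'.1, h'.2.2⟩

theorem distOf_jointLaw_source (hP0 : ∀ x, IsPMF (P0 x)) (hP : ∀ x u, IsPMF (P x u))
    (p : X × Y) :
    distOf (jointLaw q xs P0 P) (fun z => (xs z.1, ys z.1)) p =
      distOf q (fun s => (xs s, ys s)) p := by
  simp_rw [distOf_eq, mul_comm (ind _) (jointLaw q xs P0 P _)]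
  rw [sum_jointLaw_mul]
  simp_rw [← sum_mul, (hP _ _).2, one_mul, ← sum_mul, (hP0 _).2, one_mul, mul_comm]

theorem sum_jointLaw_logb_aux_ge (hq : IsPMF q) (hP0 : ∀ x, IsPMF (P0 x))
    (hP : ∀ x u, IsPMF (P x u)) :
    -Real.logb 2 (Fintype.card U) ≤
      ∑ z, jointLaw q xs P0 P z * Real.logb 2 (P0 (xs z.1) z.2.1) := by
  rw [sum_jointLaw_mul]
  simp_rw [← sum_mul, (hP _ _).2, one_mul]
  refine le_trans (le_of_eq ?_) (sum_le_sum fun s _ =>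
    mul_le_mul_of_nonneg_left (sum_mul_logb_ge (hP0 (xs s))) (hq.1 s))
  rw [← sum_mul, hq.2, one_mul]

theorem sum_jointLaw_logb_ge (hq : IsPMF q) (hP0 : ∀ x, IsPMF (P0 x))
    (hP : ∀ x u, IsPMF (P x u)) :
    -Real.logb 2 (Fintype.card V) ≤
      ∑ z, jointLaw q xs P0 P z * Real.logb 2 (P (xs z.1) z.2.1 z.2.2) := by
  rw [sum_jointLaw_mul]
  refine le_trans (le_of_eq ?_) (sum_le_sum fun s _ => mul_le_mul_of_nonneg_left
    (sum_le_sum fun u _ => mul_le_mul_of_nonneg_left (sum_mul_logb_ge (hP (xs s) u))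
      ((hP0 _).1 u)) (hq.1 s))
  simp_rw [← sum_mul, (hP0 _).2, one_mul]
  rw [← sum_mul, hq.2, one_mul]

variable [Fintype X] [Fintype Y]

theorem cmiOf_jointLaw_cond (hq : IsPMF q) (hP0 : ∀ x, IsPMF (P0 x)) (hP : ∀ x u, IsPMF (P x u)) :
    cmiOf (jointLaw q xs P0 P) (fun z => xs z.1) (fun z => z.2.2) (fun z => (z.2.1, ys z.1)) =
      ∑ z, jointLaw q xs P0 P z * Real.logb 2 (P (xs z.1) z.2.1 z.2.2)
      - ∑ z, jointLaw q xs P0 P z * Real.logb 2 (condDist (jointLaw q xs P0 P)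
        (fun z => z.2.2) (fun z => (z.2.1, ys z.1)) z.2.2 (z.2.1, ys z.1)) := by
  have hμ := isPMF_jointLaw (xs := xs) hq hP0 hP
  have h1 := entOf_prod_sub_entOf hμ.1 (fun z => z.2.2) (fun z => (z.2.1, ys z.1))
  have h2 := entOf_sub_entOf hμ.1 (fun z => (xs z.1, z.2.2, (z.2.1, ys z.1)))
    (fun z => (xs z.1, (z.2.1, ys z.1))) (c := fun z => P (xs z.1) z.2.1 z.2.2) fun z _ => by
      rw [distOf_jointLaw_source_aux hP]
      have := distOf_jointLaw_all (q := q) (xs := xs) (ys := ys) (P0 := P0) (P := P)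
        (xs z.1) (ys z.1) z.2.1 z.2.2
      rw [mul_left_comm, ← mul_assoc, ← this, distOf_eq, distOf_eq]
      refine sum_congr rfl fun z' _ => ?_
      congr 2
      simp only [Prod.mk.injEq, eq_iff_iff]
      tauto
  rw [cmiOf]
  linarith

theorem cmiOf_jointLaw_pair (hq : IsPMF q) (hP0 : ∀ x, IsPMF (P0 x)) (hP : ∀ x u, IsPMF (P x u)) :
    cmiOf (jointLaw q xs P0 P) (fun z => xs z.1) (fun z => (z.2.1, z.2.2)) (fun z => ys z.1) =
      ∑ z, jointLaw q xs P0 P z * Real.logb 2 (P0 (xs z.1) z.2.1)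
      + ∑ z, jointLaw q xs P0 P z * Real.logb 2 (P (xs z.1) z.2.1 z.2.2)
      - ∑ z, jointLaw q xs P0 P z * Real.logb 2 (condDist (jointLaw q xs P0 P)
        (fun z => (z.2.1, z.2.2)) (fun z => ys z.1) (z.2.1, z.2.2) (ys z.1)) := by
  have hμ := isPMF_jointLaw (xs := xs) hq hP0 hP
  have h1 := entOf_prod_sub_entOf hμ.1 (fun z => (z.2.1, z.2.2)) (fun z => ys z.1)
  have h2 := entOf_sub_entOf hμ.1 (fun z => (xs z.1, (z.2.1, z.2.2), ys z.1))
    (fun z => (xs z.1, ys z.1)) (c := fun z => P0 (xs z.1) z.2.1 * P (xs z.1) z.2.1 z.2.2)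
    fun z _ => by rw [distOf_jointLaw_source hP0 hP, distOf_jointLaw_all]
  have h3 : ∑ z, jointLaw q xs P0 P z *
      Real.logb 2 (P0 (xs z.1) z.2.1 * P (xs z.1) z.2.1 z.2.2) =
      ∑ z, jointLaw q xs P0 P z * Real.logb 2 (P0 (xs z.1) z.2.1)
      + ∑ z, jointLaw q xs P0 P z * Real.logb 2 (P (xs z.1) z.2.1 z.2.2) := by
    rw [← sum_add_distrib]
    refine sum_congr rfl fun z _ => ?_
    rw [← mul_add]
    by_cases h : P0 (xs z.1) z.2.1 * P (xs z.1) z.2.1 z.2.2 = 0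
    · rw [jointLaw, h]; simp
    · rw [Real.logb_mul (left_ne_zero_of_mul h) (right_ne_zero_of_mul h)]
  rw [cmiOf]
  linarith

end TestChannel

section LLNProd

variable {Z : Type*}

theorem prod_eq_rpow_sum_logb {n : ℕ} {g : Z → ℝ} {z : Fin n → Z} (hg : ∀ t, 0 < g (z t)) :
    ∏ t, g (z t) = (2 : ℝ) ^ ∑ t, Real.logb 2 (g (z t)) := by
  rw [Real.rpow_sum_of_pos two_pos]
  exact prod_congr rfl fun t _ => (Real.rpow_logb two_pos (by norm_num) (hg t)).symm

variable [Fintype Z] {μ : Z → ℝ}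

theorem prod_mul_ind_le (hμ : IsPMF μ) {n : ℕ} {z : Fin n → Z} {p p' : Prop}
    (h : (∀ t, 0 < μ (z t)) → p → p') :
    (∏ t, μ (z t)) * ind p ≤ (∏ t, μ (z t)) * ind p' := by
  by_cases h0 : ∏ t, μ (z t) = 0
  · rw [h0, zero_mul, zero_mul]
  · refine mul_le_mul_of_nonneg_left (ind_mono (h fun t => ?_)) ((isPMF_prod hμ n).1 z)
    exact (hμ.1 _).lt_of_ne' (prod_ne_zero_iff.1 h0 t (mem_univ t))

theorem tendsto_lt_prod (hμ : IsPMF μ) {g : Z → ℝ} (hg : ∀ z, 0 < μ z → 0 < g z) {δ : ℝ}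
    (hδ : 0 < δ) :
    Filter.Tendsto (fun n : ℕ => ∑ z : Fin n → Z, (∏ t, μ (z t)) *
      ind ((2 : ℝ) ^ (n * (∑ z, μ z * Real.logb 2 (g z) + δ)) < ∏ t, g (z t)))
      Filter.atTop (nhds 0) := by
  refine squeeze_zero (fun n => sum_nonneg fun z _ => mul_nonneg ((isPMF_prod hμ n).1 z)
    (ind_nonneg _)) (fun n => sum_le_sum fun z _ => prod_mul_ind_le hμ fun hz h => ?_)
    (tendsto_upper_deviation hμ (fun z => Real.logb 2 (g z)) hδ)
  rwa [prod_eq_rpow_sum_logb fun t => hg _ (hz t), Real.rpow_lt_rpow_left_iff one_lt_two] at h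

theorem tendsto_prod_lt (hμ : IsPMF μ) {g : Z → ℝ} (hg : ∀ z, 0 < μ z → 0 < g z) {δ : ℝ}
    (hδ : 0 < δ) :
    Filter.Tendsto (fun n : ℕ => ∑ z : Fin n → Z, (∏ t, μ (z t)) *
      ind (∏ t, g (z t) < (2 : ℝ) ^ (n * (∑ z, μ z * Real.logb 2 (g z) - δ))))
      Filter.atTop (nhds 0) := by
  refine squeeze_zero (fun n => sum_nonneg fun z _ => mul_nonneg ((isPMF_prod hμ n).1 z)
    (ind_nonneg _)) (fun n => sum_le_sum fun z _ => prod_mul_ind_le hμ fun hz h => ?_)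
    (tendsto_upper_deviation hμ (fun z => -Real.logb 2 (g z)) hδ)
  rw [prod_eq_rpow_sum_logb fun t => hg _ (hz t), Real.rpow_lt_rpow_left_iff one_lt_two] at h
  simp only [mul_neg, sum_neg_distrib]
  linarith

end LLNProd

theorem sum_arrow_prod {n : ℕ} {A B : Type*} [Fintype A] [Fintype B] (F : (Fin n → A × B) → ℝ) :
    ∑ z, F z = ∑ a : Fin n → A, ∑ b : Fin n → B, F fun t => (a t, b t) := by
  rw [← (Equiv.arrowProdEquivProdArrow (Fin n) (fun _ => A) fun _ => B).symm.sum_comp,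
    Fintype.sum_prod_type]
  rfl

/-- The pair `(u, v)` looks plausible to a decoder observing `y`. -/
def goodPair {U V Y : Type*} {n : ℕ} (W W' : U → V → Y → ℝ) (a b : ℝ) (u : Fin n → U)
    (v : Fin n → V) (y : Fin n → Y) : Prop :=
  a ≤ ∏ t, W (u t) (v t) (y t) ∧ b ≤ ∏ t, W' (u t) (v t) (y t)

section Counting

variable {U V Y : Type*} [Fintype V] {n : ℕ} {W W' : U → V → Y → ℝ} {a b : ℝ}

theorem ind_le_inv_mul {x a : ℝ} (ha : 0 < a) (hx : 0 ≤ x) {p : Prop} (hp : p → a ≤ x) :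
    ind p ≤ a⁻¹ * x := by
  by_cases h : p
  · rw [ind_true h, inv_mul_eq_div, one_le_div ha]
    exact hp h
  · rw [ind_false h]; positivity

theorem sum_goodPair_le (hW' : ∀ u v y, 0 ≤ W' u v y) (hs : ∀ u y, ∑ v, W' u v y ≤ 1)
    (hb : 0 < b) (u : Fin n → U) (y : Fin n → Y) : ∑ v, ind (goodPair W W' a b u v y) ≤ b⁻¹ := by
  refine (sum_le_sum fun v _ => ind_le_inv_mul hb (prod_nonneg fun t _ => hW' _ _ _)
    fun h => h.2).trans ?_
  rw [← mul_sum, ← Fintype.piFinset_univ,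
    ← prod_univ_sum (fun _ => univ) fun t v => W' (u t) v (y t)]
  exact mul_le_of_le_one_right (by positivity)
    (prod_le_one (fun t _ => sum_nonneg fun v _ => hW' _ _ _) fun t _ => hs _ _)

theorem sum_sum_goodPair_le [Fintype U] (hW : ∀ u v y, 0 ≤ W u v y)
    (hs : ∀ y, ∑ p : U × V, W p.1 p.2 y ≤ 1) (ha : 0 < a) (y : Fin n → Y) :
    ∑ u, ∑ v, ind (goodPair W W' a b u v y) ≤ a⁻¹ := by
  refine (sum_le_sum fun u _ => sum_le_sum fun v _ => ind_le_inv_mul ha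
    (prod_nonneg fun t _ => hW _ _ _) fun h => h.1).trans ?_
  simp_rw [← mul_sum]
  rw [← sum_arrow_prod fun z : Fin n → U × V => ∏ t, W (z t).1 (z t).2 (y t),
    ← Fintype.piFinset_univ, ← prod_univ_sum (fun _ => univ) fun t (p : U × V) => W p.1 p.2 (y t)]
  exact mul_le_of_le_one_right (by positivity)
    (prod_le_one (fun t _ => sum_nonneg fun v _ => hW _ _ _) fun t _ => hs _)

end Counting

section Block

variable {S X Y U V : Type*} [Fintype S] [Fintype U] [Fintype V]
  {q : S → ℝ} {xs : S → X} {ys : S → Y} {P0 : X → U → ℝ} {P : X → U → V → ℝ}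

theorem sum_prod_jointLaw {n : ℕ}
    (F : (Fin n → S) → (Fin n → U) → (Fin n → V) → ℝ) :
    ∑ z : Fin n → S × U × V, (∏ t, jointLaw q xs P0 P (z t)) *
      F (fun t => (z t).1) (fun t => (z t).2.1) (fun t => (z t).2.2) =
    ∑ s : Fin n → S, (∏ t, q (s t)) * ∑ u : Fin n → U, (∏ t, P0 (xs (s t)) (u t)) *
      ∑ v : Fin n → V, (∏ t, P (xs (s t)) (u t) (v t)) * F s u v := by
  rw [sum_arrow_prod]
  refine sum_congr rfl fun s _ => ?_
  rw [sum_arrow_prod]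
  simp_rw [mul_sum, jointLaw, prod_mul_distrib]
  exact sum_congr rfl fun u _ => sum_congr rfl fun v _ => by ring

theorem tendsto_aux_overflow (hq : IsPMF q) (hP0 : ∀ x, IsPMF (P0 x)) (hP : ∀ x u, IsPMF (P x u))
    {δ : ℝ} (hδ : 0 < δ) :
    Filter.Tendsto (fun n : ℕ => ∑ s : Fin n → S, (∏ t, q (s t)) *
      ∑ u : Fin n → U, (∏ t, P0 (xs (s t)) (u t)) *
        ind ((2 : ℝ) ^ (n * (∑ z, jointLaw q xs P0 P z * Real.logb 2 (P0 (xs z.1) z.2.1) + δ))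
          < ∏ t, P0 (xs (s t)) (u t))) Filter.atTop (nhds 0) := by
  have hμ := isPMF_jointLaw (xs := xs) hq hP0 hP
  refine (tendsto_lt_prod hμ (g := fun z => P0 (xs z.1) z.2.1) (fun z hz =>
    ((hP0 _).1 _).lt_of_ne' fun h => by simp [jointLaw, h] at hz) hδ).congr fun n => ?_
  rw [sum_prod_jointLaw fun s u _ => ind ((2 : ℝ) ^ (n * (∑ z, jointLaw q xs P0 P z *
    Real.logb 2 (P0 (xs z.1) z.2.1) + δ)) < ∏ t, P0 (xs (s t)) (u t))]
  have h1 : ∀ (s : Fin n → S) (u : Fin n → U), ∑ v : Fin n → V,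
      ∏ t, P (xs (s t)) (u t) (v t) = 1 := fun s u => (isPMF_pi fun t => hP _ _).2
  simp_rw [← sum_mul, h1, one_mul]

/-- On blocks, the ideal law avoids all failure events with high probability. -/
theorem tendsto_idealFail (hq : IsPMF q) (hP0 : ∀ x, IsPMF (P0 x)) (hP : ∀ x u, IsPMF (P x u))
    [Fintype X] [Nonempty V] {Q : X × V → ℝ}
    (hQ : ∀ a, Q a = ∑ z, jointLaw q xs P0 P z * ind ((xs z.1, z.2.2) = a))
    {W W' : U → V → Y → ℝ} (hW : ∀ z, 0 < jointLaw q xs P0 P z → 0 < W z.2.1 z.2.2 (ys z.1))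
    (hW' : ∀ z, 0 < jointLaw q xs P0 P z → 0 < W' z.2.1 z.2.2 (ys z.1))
    {ε δ : ℝ} (hε : 0 < ε) (hδ : 0 < δ) :
    Filter.Tendsto (fun n : ℕ => idealFail (fun s : Fin n → S => ∏ t, q (s t))
      (fun s t => xs (s t)) (fun s t => ys (s t))
      (fun s (v : Fin n → V) => Typical ε Q fun t => (xs (s t), v t))
      (goodPair W W'
        (2 ^ (n * (∑ z, jointLaw q xs P0 P z * Real.logb 2 (W z.2.1 z.2.2 (ys z.1)) - δ)))
        (2 ^ (n * (∑ z, jointLaw q xs P0 P z * Real.logb 2 (W' z.2.1 z.2.2 (ys z.1)) - δ))))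
      (fun x u => ∏ t, P0 (x t) (u t)) (fun x u v => ∏ t, P (x t) (u t) (v t))
      (Fintype.card V ^ n *
        2 ^ (n * (∑ z, jointLaw q xs P0 P z * Real.logb 2 (P (xs z.1) z.2.1 z.2.2) + δ))))
      Filter.atTop (nhds 0) := by
  have hμ := isPMF_jointLaw (xs := xs) hq hP0 hP
  have l1 := tendsto_not_typical hμ (fun z => (xs z.1, z.2.2)) hQ hε
  have l2 := tendsto_prod_lt hμ hW hδ
  have l3 := tendsto_prod_lt hμ hW' hδ
  have l4 := tendsto_lt_prod hμ (g := fun z => P (xs z.1) z.2.1 z.2.2) (fun z hz =>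
    ((hP _ _).1 _).lt_of_ne' fun h => by simp [jointLaw, h] at hz) hδ
  have l := (l1.add (l2.add l3)).add l4
  simp only [add_zero] at l
  refine squeeze_zero (fun n => ?_) (fun n => ?_) l
  · exact sum_nonneg fun s _ => mul_nonneg (prod_nonneg fun t _ => hq.1 _)
      (sum_nonneg fun u _ => mul_nonneg (prod_nonneg fun t _ => (hP0 _).1 _)
      (sum_nonneg fun v _ => mul_nonneg (prod_nonneg fun t _ => (hP _ _).1 _)
      (add_nonneg (ind_nonneg _) (ind_nonneg _))))
  · rw [idealFail, ← sum_prod_jointLaw fun s u v => _]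
    rw [← sum_add_distrib, ← sum_add_distrib, ← sum_add_distrib]
    refine sum_le_sum fun z _ => ?_
    rw [← mul_add, ← mul_add, ← mul_add]
    refine mul_le_mul_of_nonneg_left (add_le_add ((ind_or_le _ _).trans (add_le_add le_rfl ?_))
      (ind_mono fun h => ?_)) ((isPMF_prod hμ n).1 z)
    · refine (ind_mono fun h => ?_).trans (ind_or_le _ _)
      rw [goodPair, not_and_or, not_le, not_le] at h
      exact h
    · rw [Fintype.card_fun, Fintype.card_fin, Nat.cast_pow] at h
      exact lt_of_mul_lt_mul_left h (by positivity)

end Block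

theorem half_rpow_le_msgCard (n : ℕ) {R : ℝ} (hR : 0 ≤ R) :
    (2 : ℝ) ^ (n * R) / 2 ≤ msgCard n R := by
  have h1 : (1 : ℝ) ≤ (2 : ℝ) ^ (n * R) := Real.one_le_rpow one_le_two (by positivity)
  have h2 : (2 : ℝ) ^ (n * R) < msgCard n R + 1 := Nat.lt_floor_add_one _
  have h3 : (1 : ℝ) ≤ msgCard n R := by
    exact_mod_cast (Nat.one_le_floor_iff _).2 h1
  linarith

theorem msgCard_pos (n : ℕ) {R : ℝ} (hR : 0 ≤ R) : 0 < msgCard n R := by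
  have h := half_rpow_le_msgCard n hR
  have : (0 : ℝ) < (2 : ℝ) ^ (n * R) / 2 := by positivity
  exact_mod_cast this.trans_le h

theorem exists_codebook_size (n : ℕ) {L : ℝ} (hL : 1 ≤ L) :
    ∃ M : ℕ, M ≠ 0 ∧ (M : ℝ) ≤ (n + 2) * L ∧ Real.exp (-(M / L)) ≤ Real.exp (-n) := by
  have hL0 : 0 < L := one_pos.trans_le hL
  refine ⟨⌈n * L⌉₊ + 1, by omega, ?_, Real.exp_le_exp.2 (neg_le_neg ?_)⟩
  · have := Nat.ceil_lt_add_one (a := n * L) (by positivity)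
    push_cast
    linarith
  · rw [le_div_iff₀ hL0]
    have := Nat.le_ceil (n * L)
    push_cast
    linarith

theorem ratio_le {M a K V N c k : ℝ} (hM : M ≤ N * (V * c)) (hK : k / 2 ≤ K) (hk : 0 < k)
    (hV : 0 < V) (ha : 0 ≤ a) (hN : 0 ≤ N) (hc : 0 ≤ c) :
    M * a / (K * V) ≤ 2 * N * (c * a / k) := by
  have hK0 : 0 < K := (half_pos hk).trans_le hK
  rw [div_le_iff₀ (by positivity)]
  calc M * a ≤ N * (V * c) * a := mul_le_mul_of_nonneg_right hM ha
    _ = 2 * N * (c * a / k) * (k / 2 * V) := by field_simp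
    _ ≤ _ := by gcongr

theorem tendsto_sq_mul_rpow {g : ℝ} (hg : 0 < g) :
    Filter.Tendsto (fun n : ℕ => 4 * ((n : ℝ) + 2) ^ 2 * 2 ^ (-(n * g))) Filter.atTop (nhds 0) := by
  have hr1 : (2 : ℝ) ^ (-g) < 1 := Real.rpow_lt_one_of_one_lt_of_neg one_lt_two (neg_lt_zero.2 hg)
  have hr0 : (0 : ℝ) < (2 : ℝ) ^ (-g) := by positivity
  have h := (tendsto_pow_const_mul_const_pow_of_abs_lt_one 2
    (by rwa [abs_of_pos hr0] : |(2 : ℝ) ^ (-g)| < 1)).comp (Filter.tendsto_add_atTop_nat 2)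
  have h' := h.const_mul (4 / ((2 : ℝ) ^ (-g)) ^ 2)
  rw [mul_zero] at h'
  refine h'.congr fun n => ?_
  simp only [Function.comp_apply]
  have h2 : (2 : ℝ) ^ (-(n * g)) = ((2 : ℝ) ^ (-g)) ^ n := by
    rw [← Real.rpow_natCast, ← Real.rpow_mul two_pos.le, neg_mul, mul_comm g]
  rw [h2, pow_add]
  push_cast
  field_simp

section Block

variable {S X Y U V : Type*} [Fintype S] [Fintype U] [Fintype V]

/-- Expected log-likelihood of the auxiliary letter given the source. -/
def auxLogLik (q : S → ℝ) (xs : S → X) (P0 : X → U → ℝ) : ℝ :=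
  ∑ s, q s * ∑ u, P0 (xs s) u * Real.logb 2 (P0 (xs s) u)

/-- Expected log-likelihood of the reconstruction given the source and the auxiliary letter. -/
def recLogLik (q : S → ℝ) (xs : S → X) (P0 : X → U → ℝ) (P : X → U → V → ℝ) : ℝ :=
  ∑ z, jointLaw q xs P0 P z * Real.logb 2 (P (xs z.1) z.2.1 z.2.2)

variable {q : S → ℝ} {xs : S → X} {ys : S → Y} {P0 : X → U → ℝ} {P : X → U → V → ℝ}

theorem sum_jointLaw_logb_aux (hP : ∀ x u, IsPMF (P x u)) :
    ∑ z, jointLaw q xs P0 P z * Real.logb 2 (P0 (xs z.1) z.2.1) = auxLogLik q xs P0 := by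
  rw [sum_jointLaw_mul, auxLogLik]
  simp_rw [← sum_mul, (hP _ _).2, one_mul]

theorem exists_plausibility_test [Fintype X] [Fintype Y] [Nonempty V] (hq : IsPMF q)
    (hP0 : ∀ x, IsPMF (P0 x))
    (hP : ∀ x u, IsPMF (P x u)) {Q : X × V → ℝ}
    (hQ : ∀ a, Q a = ∑ z, jointLaw q xs P0 P z * ind ((xs z.1, z.2.2) = a))
    {ε δ : ℝ} (hε : 0 < ε) (hδ : 0 < δ) :
    ∃ Good : (n : ℕ) → (Fin n → U) → (Fin n → V) → (Fin n → Y) → Prop,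
      (∀ n u y, ∑ v, ind (Good n u v y) ≤ (2 : ℝ) ^ (n * (cmiOf (jointLaw q xs P0 P)
        (fun z => xs z.1) (fun z => z.2.2) (fun z => (z.2.1, ys z.1))
        - recLogLik q xs P0 P + δ))) ∧
      (∀ n y, ∑ u, ∑ v, ind (Good n u v y) ≤ (2 : ℝ) ^ (n * (cmiOf (jointLaw q xs P0 P)
        (fun z => xs z.1) (fun z => (z.2.1, z.2.2)) (fun z => ys z.1)
        - auxLogLik q xs P0 - recLogLik q xs P0 P + δ))) ∧
      Filter.Tendsto (fun n : ℕ => idealFail (fun s : Fin n → S => ∏ t, q (s t))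
        (fun s t => xs (s t)) (fun s t => ys (s t))
        (fun s (v : Fin n → V) => Typical ε Q fun t => (xs (s t), v t)) (Good n)
        (fun x u => ∏ t, P0 (x t) (u t)) (fun x u v => ∏ t, P (x t) (u t) (v t))
        (Fintype.card V ^ n * 2 ^ (n * (recLogLik q xs P0 P + δ)))) Filter.atTop (nhds 0) := by
  have hμ := isPMF_jointLaw (xs := xs) hq hP0 hP
  set μ := jointLaw q xs P0 P with hμdef
  set W : U → V → Y → ℝ := fun u v y =>
    condDist μ (fun z => (z.2.1, z.2.2)) (fun z => ys z.1) (u, v) y with hW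
  set W' : U → V → Y → ℝ := fun u v y =>
    condDist μ (fun z => z.2.2) (fun z => (z.2.1, ys z.1)) v (u, y) with hW'
  refine ⟨fun n => goodPair W W' (2 ^ (n * (∑ z, μ z * Real.logb 2 (W z.2.1 z.2.2 (ys z.1)) - δ)))
    (2 ^ (n * (∑ z, μ z * Real.logb 2 (W' z.2.1 z.2.2 (ys z.1)) - δ))), fun n u y => ?_,
    fun n y => ?_, tendsto_idealFail hq hP0 hP hQ
      (fun z hz => condDist_pos hμ.1 (fun z => (z.2.1, z.2.2)) (fun z => ys z.1) hz)
      (fun z hz => condDist_pos hμ.1 (fun z => z.2.2) (fun z => (z.2.1, ys z.1)) hz) hε hδ⟩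
  · have h : ∀ u y, ∑ v, W' u v y ≤ 1 := fun u y =>
      sum_condDist_le μ (fun z => z.2.2) (fun z => (z.2.1, ys z.1)) (u, y)
    refine (sum_goodPair_le (W := W) (W' := W') (fun _ _ _ => condDist_nonneg hμ.1 _ _ _ _) h
      (by positivity) u y).trans (le_of_eq ?_)
    rw [cmiOf_jointLaw_cond hq hP0 hP, ← Real.rpow_neg two_pos.le, recLogLik]
    congr 1
    ring
  · have h : ∀ y, ∑ p : U × V, W p.1 p.2 y ≤ 1 := fun y =>
      sum_condDist_le μ (fun z => (z.2.1, z.2.2)) (fun z => ys z.1) y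
    refine (sum_sum_goodPair_le (W := W) (W' := W') (fun _ _ _ => condDist_nonneg hμ.1 _ _ _ _) h
      (by positivity) y).trans (le_of_eq ?_)
    rw [cmiOf_jointLaw_pair hq hP0 hP, sum_jointLaw_logb_aux hP, ← Real.rpow_neg two_pos.le,
      recLogLik]
    congr 1
    ring

end Block

theorem one_le_pow_mul_rpow {A : Type*} [Fintype A] [Nonempty A] (n : ℕ) {c δ : ℝ}
    (hc : -Real.logb 2 (Fintype.card A) ≤ c) (hδ : 0 < δ) :
    1 ≤ (Fintype.card A : ℝ) ^ n * 2 ^ (n * (c + δ)) := by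
  have hA : (0 : ℝ) < Fintype.card A := by exact_mod_cast Fintype.card_pos
  have h : (Fintype.card A : ℝ) ^ n = 2 ^ (n * Real.logb 2 (Fintype.card A)) := by
    rw [mul_comm, Real.rpow_mul two_pos.le, Real.rpow_logb two_pos (by norm_num) hA,
      Real.rpow_natCast]
  rw [h, ← Real.rpow_add two_pos, ← mul_add]
  exact Real.one_le_rpow one_le_two (mul_nonneg n.cast_nonneg (by linarith))

/-- The probability of decoding to a wrong codeword, on blocks. -/
theorem collision_term_le {n : ℕ} {M0 M K0 K1 A B c0 c I1 I2 R0 R1 δ : ℝ} (hA : 0 < A) (hB : 0 < B)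
    (hM : 0 ≤ M) (hM0 : M0 ≤ (n + 2) * (A * 2 ^ (n * (c0 + δ))))
    (hM1 : M ≤ (n + 2) * (B * 2 ^ (n * (c + δ))))
    (hK0 : (2 : ℝ) ^ (n * R0) / 2 ≤ K0) (hK1 : (2 : ℝ) ^ (n * R1) / 2 ≤ K1) :
    M0 * M * 2 ^ (n * (I2 - c0 - c + δ)) / (K0 * K1 * A * B)
      + M * 2 ^ (n * (I1 - c + δ)) / (K1 * B) ≤
    4 * ((n : ℝ) + 2) ^ 2 * 2 ^ (-(n * (R0 + R1 - I2 - 3 * δ)))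
      + 4 * ((n : ℝ) + 2) ^ 2 * 2 ^ (-(n * (R1 - I1 - 2 * δ))) := by
  have hn : (0 : ℝ) ≤ n := n.cast_nonneg
  have hK1' : 0 < K1 := lt_of_lt_of_le (by positivity) hK1
  have hK0' : 0 < K0 := lt_of_lt_of_le (by positivity) hK0
  refine add_le_add ?_ ?_
  · have h1 := ratio_le hM1 hK1 (by positivity) hB
      (a := (2 : ℝ) ^ (n * (I2 - c0 - c + δ))) (by positivity) (by positivity) (by positivity)
    have h2 := ratio_le hM0 hK0 (by positivity) hA (a := 1) zero_le_one (by positivity)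
      (by positivity)
    calc M0 * M * 2 ^ (n * (I2 - c0 - c + δ)) / (K0 * K1 * A * B)
        = (M0 * 1 / (K0 * A)) * (M * 2 ^ (n * (I2 - c0 - c + δ)) / (K1 * B)) := by
          field_simp
      _ ≤ _ := mul_le_mul h2 h1 (by positivity) (by positivity)
      _ = 4 * ((n : ℝ) + 2) ^ 2 * ((2 ^ (n * (c0 + δ)) / 2 ^ (n * R0)) *
          (2 ^ (n * (c + δ)) * 2 ^ (n * (I2 - c0 - c + δ)) / 2 ^ (n * R1))) := by ring
      _ = _ := by
          rw [← Real.rpow_add two_pos, ← Real.rpow_sub two_pos, ← Real.rpow_sub two_pos,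
            ← Real.rpow_add two_pos]
          congr 2
          ring
  · refine (ratio_le hM1 hK1 (by positivity) hB (by positivity) (by positivity)
      (by positivity)).trans ?_
    rw [← Real.rpow_add two_pos, ← Real.rpow_sub two_pos]
    have h : (n : ℝ) * (c + δ) + n * (I1 - c + δ) - n * R1 = -(n * (R1 - I1 - 2 * δ)) := by ring
    rw [h]
    exact mul_le_mul_of_nonneg_right (by nlinarith) (by positivity)

section Block

variable {S X Y Y' U V V' : Type*} [Fintype S] [Fintype X] [Fintype Y] [Fintype Y'] [Fintype U]
  [Fintype V] [Fintype V'] [Nonempty U] [Nonempty V] [Nonempty V']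
  {q : S → ℝ} {xs : S → X} {ys : S → Y} {ys' : S → Y'} {P0 : X → U → ℝ} {P : X → U → V → ℝ}
  {P' : X → U → V' → ℝ}

/-- Achievability for test channels in which the two reconstructions are specified separately. -/
theorem exists_block_codes (hq : IsPMF q) (hP0 : ∀ x, IsPMF (P0 x))
    (hP : ∀ x u, IsPMF (P x u)) (hP' : ∀ x u, IsPMF (P' x u)) {Q : X × V → ℝ} {Q' : X × V' → ℝ}
    (hQ : ∀ a, Q a = ∑ z, jointLaw q xs P0 P z * ind ((xs z.1, z.2.2) = a))
    (hQ' : ∀ a, Q' a = ∑ z, jointLaw q xs P0 P' z * ind ((xs z.1, z.2.2) = a))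
    {ε R0 R1 R2 : ℝ} (hε : 0 < ε) (hR0 : 0 ≤ R0) (hR1 : 0 ≤ R1) (hR2 : 0 ≤ R2)
    (h1 : cmiOf (jointLaw q xs P0 P) (fun z => xs z.1) (fun z => z.2.2)
      (fun z => (z.2.1, ys z.1)) < R1)
    (h2 : cmiOf (jointLaw q xs P0 P') (fun z => xs z.1) (fun z => z.2.2)
      (fun z => (z.2.1, ys' z.1)) < R2)
    (h01 : cmiOf (jointLaw q xs P0 P) (fun z => xs z.1) (fun z => (z.2.1, z.2.2))
      (fun z => ys z.1) < R0 + R1)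
    (h02 : cmiOf (jointLaw q xs P0 P') (fun z => xs z.1) (fun z => (z.2.1, z.2.2))
      (fun z => ys' z.1) < R0 + R2) :
    ∃ b : ℕ → ℝ, Filter.Tendsto b Filter.atTop (nhds 0) ∧ ∀ n,
      ∃ (enc : (Fin n → X) → Fin (msgCard n R0) × Fin (msgCard n R1) × Fin (msgCard n R2))
        (r1 : Fin (msgCard n R0) × Fin (msgCard n R1) → (Fin n → Y) → Fin n → V)
        (r2 : Fin (msgCard n R0) × Fin (msgCard n R2) → (Fin n → Y') → Fin n → V'),
        ∑ s : Fin n → S, (∏ t, q (s t)) * ind (¬Typical ε Q fun t => (xs (s t),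
            r1 ((enc fun t => xs (s t)).1, (enc fun t => xs (s t)).2.1) (fun t => ys (s t)) t))
          + ∑ s : Fin n → S, (∏ t, q (s t)) * ind (¬Typical ε Q' fun t => (xs (s t),
            r2 ((enc fun t => xs (s t)).1, (enc fun t => xs (s t)).2.2) (fun t => ys' (s t)) t))
          ≤ b n := by
  obtain ⟨δ, hδ, hδ1, hδ2, hδ01, hδ02⟩ : ∃ δ : ℝ, 0 < δ ∧
      0 < R1 - cmiOf (jointLaw q xs P0 P) (fun z => xs z.1) (fun z => z.2.2)
        (fun z => (z.2.1, ys z.1)) - 2 * δ ∧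
      0 < R2 - cmiOf (jointLaw q xs P0 P') (fun z => xs z.1) (fun z => z.2.2)
        (fun z => (z.2.1, ys' z.1)) - 2 * δ ∧
      0 < R0 + R1 - cmiOf (jointLaw q xs P0 P) (fun z => xs z.1) (fun z => (z.2.1, z.2.2))
        (fun z => ys z.1) - 3 * δ ∧
      0 < R0 + R2 - cmiOf (jointLaw q xs P0 P') (fun z => xs z.1) (fun z => (z.2.1, z.2.2))
        (fun z => ys' z.1) - 3 * δ := by
    have e : ∀ {I R : ℝ} {c : ℝ}, I < R → 0 < c → ∀ᶠ δ in nhdsWithin (0 : ℝ) (Set.Ioi 0),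
        0 < R - I - c * δ := fun {I R c} h hc => by
      filter_upwards [Ioo_mem_nhdsGT (div_pos (sub_pos.2 h) hc)] with δ hδ
      have := (lt_div_iff₀ hc).1 hδ.2
      linarith
    obtain ⟨δ, h⟩ := (Filter.Eventually.and
      (eventually_mem_nhdsWithin : ∀ᶠ δ in nhdsWithin (0 : ℝ) (Set.Ioi 0), δ ∈ Set.Ioi (0 : ℝ))
        ((e h1 two_pos).and ((e h2 two_pos).and
        ((e h01 three_pos).and (e h02 three_pos))))).exists
    exact ⟨δ, h⟩
  obtain ⟨G, hG1, hG0, hG⟩ := exists_plausibility_test (ys := ys) hq hP0 hP hQ hε hδ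
  obtain ⟨G', hG1', hG0', hG'⟩ := exists_plausibility_test (ys := ys') hq hP0 hP' hQ' hε hδ
  have hov := tendsto_aux_overflow (xs := xs) hq hP0 hP hδ
  rw [sum_jointLaw_logb_aux hP] at hov
  have hexp : Filter.Tendsto (fun n : ℕ => Real.exp (-(n : ℝ))) Filter.atTop (nhds 0) :=
    Real.tendsto_exp_neg_atTop_nhds_zero.comp tendsto_natCast_atTop_atTop
  have hb := (((hG.add hG').add (hov.const_mul 4)).add ((hexp.add hexp).add
    (hexp.const_mul 4))).add ((tendsto_sq_mul_rpow hδ01).add (tendsto_sq_mul_rpow hδ1))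
  have hb' := hb.add ((tendsto_sq_mul_rpow hδ02).add (tendsto_sq_mul_rpow hδ2))
  simp only [mul_zero, add_zero] at hb'
  refine ⟨_, hb', fun n => ?_⟩
  have hL0 := one_le_pow_mul_rpow n
    ((sum_jointLaw_logb_aux_ge (xs := xs) hq hP0 hP).trans_eq (sum_jointLaw_logb_aux hP)) hδ
  have hL := one_le_pow_mul_rpow n (sum_jointLaw_logb_ge (xs := xs) hq hP0 hP) hδ
  have hL' := one_le_pow_mul_rpow n (sum_jointLaw_logb_ge (xs := xs) hq hP0 hP') hδ
  obtain ⟨M0, hM0, hM0L, hM0e⟩ := exists_codebook_size n hL0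
  obtain ⟨M, hM, hML, hMe⟩ := exists_codebook_size n hL
  obtain ⟨M', hM', hML', hMe'⟩ := exists_codebook_size n hL'
  have := NeZero.mk hM0
  have := NeZero.mk hM
  have := NeZero.mk hM'
  have := NeZero.of_pos (msgCard_pos n hR0)
  have := NeZero.of_pos (msgCard_pos n hR1)
  have := NeZero.of_pos (msgCard_pos n hR2)
  obtain ⟨enc, r1, r2, h⟩ := exists_code (K0 := Fin (msgCard n R0)) (K1 := Fin (msgCard n R1))
    (K2 := Fin (msgCard n R2)) (xs := fun (s : Fin n → S) t => xs (s t))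
    (ys := fun s t => ys (s t)) (ys' := fun s t => ys' (s t))
    (ok := fun s v => Typical ε Q fun t => (xs (s t), v t))
    (ok' := fun s v => Typical ε Q' fun t => (xs (s t), v t))
    (isPMF_prod hq n) (P0 := fun x u => ∏ t, P0 (x t) (u t)) (fun x => isPMF_pi fun t => hP0 _)
    (P := fun x u v => ∏ t, P (x t) (u t) (v t))
    (P' := fun x u v => ∏ t, P' (x t) (u t) (v t))
    (fun x u => isPMF_pi fun t => hP _ _) (fun x u => isPMF_pi fun t => hP' _ _)
    (one_pos.trans_le hL0) (one_pos.trans_le hL) (one_pos.trans_le hL') (hG1 n) (hG0 n) (hG1' n)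
    (hG0' n) M0 M M'
  refine ⟨enc, r1, r2, h.trans ?_⟩
  simp only [Fintype.card_fun, Fintype.card_fin, Nat.cast_pow]
  have hU : (0 : ℝ) < (Fintype.card U : ℝ) ^ n := by positivity
  have hV : (0 : ℝ) < (Fintype.card V : ℝ) ^ n := by positivity
  have hV' : (0 : ℝ) < (Fintype.card V' : ℝ) ^ n := by positivity
  refine (add_le_add (add_le_add (add_le_add le_rfl (add_le_add (add_le_add hMe hMe')
    (mul_le_mul_of_nonneg_left hM0e (by norm_num))))
    (collision_term_le hU hV M.cast_nonneg hM0L hML (half_rpow_le_msgCard n hR0)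
      (half_rpow_le_msgCard n hR1)))
    (collision_term_le hU hV' M'.cast_nonneg hM0L hML' (half_rpow_le_msgCard n hR0)
      (half_rpow_le_msgCard n hR2))).trans (le_of_eq ?_)
  simp only [mul_lt_mul_iff_right₀ hU]
  rfl

end Block

section Marginals

theorem cmiOf_distOf {Ω Z A B C : Type*} [Fintype Ω] [Fintype Z] [Fintype A] [Fintype B]
    [Fintype C] (w : Ω → ℝ) (π : Ω → Z) (F : Z → A) (G : Z → B) (H : Z → C) :
    cmiOf (distOf w π) F G H =
      cmiOf w (fun ω => F (π ω)) (fun ω => G (π ω)) (fun ω => H (π ω)) := by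
  simp only [cmiOf, entOf_distOf]

theorem isPMF_distOf {Ω A : Type*} [Fintype Ω] [Fintype A] {w : Ω → ℝ} (hw : IsPMF w)
    (F : Ω → A) : IsPMF (distOf w F) := by
  refine ⟨distOf_nonneg hw.1 F, ?_⟩
  simp_rw [distOf_eq]
  rw [sum_fiber_ind F fun ω _ => w ω, hw.2]

theorem distOf_prodMk_fst {S W B : Type*} [Fintype S] [Fintype W] (q : S → ℝ) (K : S → W → ℝ)
    (G : W → B) (s : S) (b : B) :
    distOf (fun z : S × W => q z.1 * K z.1 z.2) (fun z => (z.1, G z.2)) (s, b) =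
      q s * distOf (K s) G b := by
  simp_rw [distOf_eq, Fintype.sum_prod_type]
  rw [sum_eq_single s, mul_sum]
  · refine sum_congr rfl fun c _ => ?_
    simp only [ind, Prod.mk.injEq, true_and]
    ring
  · intro s' _ h; simp [ind, h]
  · simp

theorem exists_test_channel {S X W U V : Type*} [Fintype S] [Fintype W] [Fintype U] [Fintype V]
    [Nonempty V] {K : X → W → ℝ} (hK : ∀ x c, 0 ≤ K x c) (F : W → U) (G : W → V) :
    ∃ P : X → U → V → ℝ, (∀ x u, IsPMF (P x u)) ∧ ∀ (q : S → ℝ) (xs : S → X),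
      jointLaw q xs (fun x => distOf (K x) F) P =
        distOf (fun z : S × W => q z.1 * K (xs z.1) z.2) fun z => (z.1, F z.2, G z.2) := by
  choose P hP hJ using fun x => exists_disintegration
    (J := fun u v => distOf (K x) (fun c => (F c, G c)) (u, v)) fun u v => distOf_nonneg (hK x) _ _
  refine ⟨P, hP, fun q xs => funext fun ⟨s, u, v⟩ => ?_⟩
  rw [distOf_prodMk_fst q (fun s => K (xs s)) (fun c => (F c, G c)), ← hJ]
  simp only [jointLaw]
  congr 2
  simp_rw [distOf_eq]
  rw [← sum_fiber_ind G fun c _ => ind (F c = u) * K (xs s) c]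
  refine sum_congr rfl fun v' _ => sum_congr rfl fun c _ => ?_
  simp only [ind, Prod.mk.injEq]
  by_cases h1 : F c = u <;> by_cases h2 : G c = v' <;> simp [h1, h2]

theorem distOf_source_prod {X Y1 Y2 W V : Type*} [Fintype X] [Fintype Y1] [Fintype Y2] [Fintype W]
    (PXY : X × Y1 × Y2 → ℝ) (K : X → W → ℝ) (G : W → V) (x : X) (v : V) :
    distOf (fun z : (X × Y1 × Y2) × W => PXY z.1 * K z.1.1 z.2) (fun z => (z.1.1, G z.2)) (x, v) =
      PXmarg PXY x * distOf (K x) G v := by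
  simp_rw [distOf_eq, Fintype.sum_prod_type, PXmarg]
  rw [sum_eq_single x, sum_mul]
  · refine sum_congr rfl fun y1 _ => ?_
    rw [sum_mul]
    refine sum_congr rfl fun y2 _ => ?_
    rw [mul_sum]
    refine sum_congr rfl fun c _ => ?_
    simp only [ind, Prod.mk.injEq, true_and]
    ring
  · intro x' _ h; simp [ind, h]
  · simp

theorem IsPMF.nonempty {A : Type*} [Fintype A] {p : A → ℝ} (hp : IsPMF p) : Nonempty A := by
  by_contra h
  rw [not_nonempty_iff] at h
  simpa using hp.2

end Marginals

theorem achievableLGW_of_lgwInnerCond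
    {X Y1 Y2 V1 V2 : Type*} [Fintype X] [Fintype Y1] [Fintype Y2] [Fintype V1] [Fintype V2]
    {PXY : X × Y1 × Y2 → ℝ} {PV1 : X → V1 → ℝ} {PV2 : X → V2 → ℝ} (hPXY : IsPMF PXY)
    {R0 R1 R2 : ℝ} (hR0 : 0 ≤ R0) (hR1 : 0 ≤ R1) (hR2 : 0 ≤ R2)
    (h : LGWInnerCond PXY PV1 PV2 R0 R1 R2) : AchievableLGW PXY PV1 PV2 R0 R1 R2 := by
  refine ⟨hR0, hR1, hR2, fun ε hε => ?_⟩
  obtain ⟨k, PV, hPV, hm1, hm2, h1, h2, h01, h02⟩ := h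
  obtain ⟨x0, -⟩ := hPXY.nonempty
  obtain ⟨u0, v1, v2⟩ := (hPV x0).nonempty
  have : Nonempty (Fin k) := ⟨u0⟩
  have : Nonempty V1 := ⟨v1⟩
  have : Nonempty V2 := ⟨v2⟩
  obtain ⟨P, hP, hJ⟩ := exists_test_channel (S := X × Y1 × Y2) (fun x => (hPV x).1)
    (fun c => c.1) (fun c => c.2.1)
  obtain ⟨P', hP', hJ'⟩ := exists_test_channel (S := X × Y1 × Y2) (fun x => (hPV x).1)
    (fun c => c.1) (fun c => c.2.2)
  specialize hJ PXY fun s => s.1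
  specialize hJ' PXY fun s => s.1
  have hQ : ∀ a : X × V1, PXmarg PXY a.1 * PV1 a.1 a.2 =
      ∑ z, jointLaw PXY (fun s => s.1) (fun x => distOf (PV x) fun c => c.1) P z *
        ind ((z.1.1, z.2.2) = a) := fun ⟨x, v⟩ => by
    simp_rw [mul_comm _ (ind _)]
    rw [← distOf_eq _ fun z : (X × Y1 × Y2) × Fin k × V1 => (z.1.1, z.2.2), hJ, distOf_distOf,
      distOf_source_prod PXY PV fun c => c.2.1, ← hm1, distOf_eq, Fintype.sum_prod_type]
    refine congrArg _ (sum_congr rfl fun u _ => ?_)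
    rw [Fintype.sum_prod_type, sum_comm]
    simp [ind]
  have hQ' : ∀ a : X × V2, PXmarg PXY a.1 * PV2 a.1 a.2 =
      ∑ z, jointLaw PXY (fun s => s.1) (fun x => distOf (PV x) fun c => c.1) P' z *
        ind ((z.1.1, z.2.2) = a) := fun ⟨x, v⟩ => by
    simp_rw [mul_comm _ (ind _)]
    rw [← distOf_eq _ fun z : (X × Y1 × Y2) × Fin k × V2 => (z.1.1, z.2.2), hJ', distOf_distOf,
      distOf_source_prod PXY PV fun c => c.2.2, ← hm2, distOf_eq, Fintype.sum_prod_type]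
    refine congrArg _ (sum_congr rfl fun u _ => ?_)
    rw [Fintype.sum_prod_type]
    simp [ind]
  obtain ⟨b, hb, hcode⟩ := exists_block_codes (ys := fun s => s.2.1) (ys' := fun s => s.2.2) hPXY
    (fun x => isPMF_distOf (hPV x) _) hP hP' hQ hQ' hε hR0 hR1 hR2
    (by rw [hJ, cmiOf_distOf]; exact h1) (by rw [hJ', cmiOf_distOf]; exact h2)
    (by rw [hJ, cmiOf_distOf]; exact h01) (by rw [hJ', cmiOf_distOf]; exact h02)
  choose enc rec1 rec2 hfail using hcode
  have fail1 : ∀ n, lgwFail1 PXY PV1 ε n R0 R1 R2 (enc n) (rec1 n) =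
      ∑ s : Fin n → X × Y1 × Y2, (∏ t, PXY (s t)) *
      ind (¬Typical ε (fun a : X × V1 => PXmarg PXY a.1 * PV1 a.1 a.2) fun t => ((s t).1,
        rec1 n ((enc n fun t => (s t).1).1, (enc n fun t => (s t).1).2.1)
          (fun t => (s t).2.1) t)) := fun n => by
    simp only [lgwFail1, ind]
    congr!
  have fail2 : ∀ n, lgwFail2 PXY PV2 ε n R0 R1 R2 (enc n) (rec2 n) =
      ∑ s : Fin n → X × Y1 × Y2, (∏ t, PXY (s t)) *
      ind (¬Typical ε (fun a : X × V2 => PXmarg PXY a.1 * PV2 a.1 a.2) fun t => ((s t).1,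
        rec2 n ((enc n fun t => (s t).1).1, (enc n fun t => (s t).1).2.2)
          (fun t => (s t).2.2) t)) := fun n => by
    simp only [lgwFail2, ind]
    congr!
  simp_rw [← fail1, ← fail2] at hfail
  have nonneg : ∀ {n : ℕ} (p : (Fin n → X × Y1 × Y2) → Prop),
      0 ≤ ∑ s, (∏ t, PXY (s t)) * ind (p s) := fun p =>
    sum_nonneg fun s _ => mul_nonneg (prod_nonneg fun t _ => hPXY.1 _) (ind_nonneg _)
  have nonneg1 := fun n => (nonneg _).trans_eq (fail1 n).symm
  have nonneg2 := fun n => (nonneg _).trans_eq (fail2 n).symm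
  exact ⟨enc, rec1, rec2,
    squeeze_zero nonneg1 (fun n => le_of_add_le_of_nonneg_left (hfail n) (nonneg2 n)) hb,
    squeeze_zero nonneg2 (fun n => le_of_add_le_of_nonneg_right (hfail n) (nonneg1 n)) hb⟩

end BCFB
namespace BCFB

/-- **Theorem 2 (achievability).** `R_LGW^{inner} ⊆ R_LGW`. -/
theorem lgwInner_subset_RLGW
    {X Y1 Y2 V1 V2 : Type*} [Fintype X] [Fintype Y1] [Fintype Y2] [Fintype V1] [Fintype V2]
    (PXY : X × Y1 × Y2 → ℝ) (PV1 : X → V1 → ℝ) (PV2 : X → V2 → ℝ)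
    (hPXY : IsPMF PXY) (hPV1 : IsKernel PV1) (hPV2 : IsKernel PV2) :
    LGWInner PXY PV1 PV2 ⊆ RLGW PXY PV1 PV2 := by
  exact closure_mono fun r ⟨hR0, hR1, hR2, h⟩ => achievableLGW_of_lgwInnerCond hPXY hR0 hR1 hR2 h

end BCFB
end
end

section
/- (Theorem 2, convexity) For every lossy Gray–Wyner source coding setup with side-information, the region R_LGW^{inner} is a convex subset of ℝ³. -/
open scoped BigOperators Classical

noncomputable section

namespace BCFB

lemma sum_distOf {Ω A : Type*} [Fintype Ω] [Fintype A] (w : Ω → ℝ) (F : Ω → A) :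
    ∑ a, distOf w F a = ∑ ω, w ω := by
  unfold distOf prOf
  rw [Finset.sum_comm]
  simp

lemma entOf_comp_injective {Ω A B : Type*} [Fintype Ω] [Fintype A] [Fintype B] (w : Ω → ℝ)
    (F : Ω → A) (e : A → B) (he : Function.Injective e) :
    entOf w (fun ω => e (F ω)) = entOf w F := by
  unfold entOf
  congr 1
  have hd : ∀ a, distOf w (fun ω => e (F ω)) (e a) = distOf w F a := fun a => by
    simp only [distOf, prOf, he.eq_iff]
  symm
  apply Finset.sum_of_injOn e he.injOn
  · simp
  · intro b _ hb
    have hz : distOf w (fun ω => e (F ω)) b = 0 := by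
      refine Finset.sum_eq_zero fun ω _ => if_neg fun h => hb ?_
      exact ⟨F ω, by simp, h⟩
    simp [hz]
  · intro a _
    rw [hd]

/-- Entropy of a mixture whose two components take values in disjoint sets. -/
lemma entOf_disjoint_mixture {Ω Ω₁ Ω₂ A : Type*} [Fintype Ω] [Fintype Ω₁] [Fintype Ω₂]
    [Fintype A] {w : Ω → ℝ} {w₁ : Ω₁ → ℝ} {w₂ : Ω₂ → ℝ} {t s : ℝ} (ι₁ : Ω₁ → Ω) (ι₂ : Ω₂ → Ω)
    (hsum : ∀ g : Ω → ℝ, ∑ z, g z = ∑ z, g (ι₁ z) + ∑ z, g (ι₂ z))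
    (hw₁ : ∀ z, w (ι₁ z) = t * w₁ z) (hw₂ : ∀ z, w (ι₂ z) = s * w₂ z)
    (h₁ : ∑ z, w₁ z = 1) (h₂ : ∑ z, w₂ z = 1) (F : Ω → A)
    (hF : ∀ z z', F (ι₁ z) ≠ F (ι₂ z')) :
    entOf w F = t * entOf w₁ (fun z => F (ι₁ z)) + s * entOf w₂ (fun z => F (ι₂ z))
      + (-(t * Real.logb 2 t) - s * Real.logb 2 s) := by
  have hd : ∀ a, distOf w F a =
      t * distOf w₁ (fun z => F (ι₁ z)) a + s * distOf w₂ (fun z => F (ι₂ z)) a := by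
    intro a
    simp only [distOf, prOf, hsum, hw₁, hw₂, Finset.mul_sum, mul_ite, mul_zero]
  have hz : ∀ a, distOf w₁ (fun z => F (ι₁ z)) a = 0 ∨ distOf w₂ (fun z => F (ι₂ z)) a = 0 := by
    intro a
    by_cases h : ∃ z, F (ι₁ z) = a
    · obtain ⟨z, rfl⟩ := h
      exact Or.inr (Finset.sum_eq_zero fun z' _ => if_neg (hF z z').symm)
    · exact Or.inl (Finset.sum_eq_zero fun z' _ => if_neg fun h' => h ⟨z', h'⟩)
  have hlog : ∀ u p : ℝ, (u * p) * Real.logb 2 (u * p) =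
      u * (p * Real.logb 2 p) + p * (u * Real.logb 2 u) := by
    intro u p
    by_cases hu : u = 0
    · simp [hu]
    by_cases hp : p = 0
    · simp [hp]
    rw [Real.logb_mul hu hp]
    ring
  have hpt : ∀ a, distOf w F a * Real.logb 2 (distOf w F a) =
      t * (distOf w₁ (fun z => F (ι₁ z)) a * Real.logb 2 (distOf w₁ (fun z => F (ι₁ z)) a))
      + distOf w₁ (fun z => F (ι₁ z)) a * (t * Real.logb 2 t)
      + (s * (distOf w₂ (fun z => F (ι₂ z)) a * Real.logb 2 (distOf w₂ (fun z => F (ι₂ z)) a))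
      + distOf w₂ (fun z => F (ι₂ z)) a * (s * Real.logb 2 s)) := by
    intro a
    rw [hd, ← hlog, ← hlog]
    rcases hz a with h | h <;> simp [h]
  unfold entOf
  simp only [hpt, Finset.sum_add_distrib, ← Finset.mul_sum, ← Finset.sum_mul, sum_distOf, h₁, h₂]
  ring

section TimeSharing

variable {S X V P Q : Type*} [Fintype S] [Fintype X] [Fintype V] [Fintype P] [Fintype Q]

/-- The kernel that uses `K₁` with weight `t` and `K₂` with weight `s`, and reveals in its first
output which of the two was used. -/
def mixKernel {k₁ k₂ : ℕ} (t s : ℝ) (K₁ : X → Fin k₁ × V → ℝ) (K₂ : X → Fin k₂ × V → ℝ) :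
    X → Fin (k₁ + k₂) × V → ℝ :=
  fun x v => Fin.addCases (fun i => t * K₁ x (i, v.2)) (fun j => s * K₂ x (j, v.2)) v.1

/-- The joint weight of a source with weight `p` and a kernel applied to its component `c`. -/
def jointWeight {k : ℕ} (p : S → ℝ) (c : S → X) (K : X → Fin k × V → ℝ) :
    S × Fin k × V → ℝ :=
  fun z => p z.1 * K (c z.1) z.2

lemma isKernel_mixKernel {k₁ k₂ : ℕ} {t s : ℝ} (ht : 0 ≤ t) (hs : 0 ≤ s) (hts : t + s = 1)
    {K₁ : X → Fin k₁ × V → ℝ} {K₂ : X → Fin k₂ × V → ℝ} (h₁ : IsKernel K₁) (h₂ : IsKernel K₂) :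
    IsKernel (mixKernel t s K₁ K₂) := by
  intro x
  constructor
  · rintro ⟨i, v⟩
    refine Fin.addCases (fun i => ?_) (fun i => ?_) i
    · simpa [mixKernel] using mul_nonneg ht ((h₁ x).1 (i, v))
    · simpa [mixKernel] using mul_nonneg hs ((h₂ x).1 (i, v))
  · have e₁ := (h₁ x).2
    have e₂ := (h₂ x).2
    rw [Fintype.sum_prod_type] at e₁ e₂ ⊢
    simp only [mixKernel, Fin.sum_univ_add, Fin.addCases_left, Fin.addCases_right,
      ← Finset.mul_sum, e₁, e₂]
    linarith

lemma distOf_jointWeight_source {B : Type*} {k : ℕ} (p : S → ℝ) (c : S → X) {K : X → Fin k × V → ℝ}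
    (hK : IsKernel K) (f : S → B) :
    distOf (jointWeight p c K) (fun z => f z.1) = distOf p f := by
  funext a
  simp only [distOf, prOf, jointWeight]
  rw [Fintype.sum_prod_type]
  refine Finset.sum_congr rfl fun x _ => ?_
  by_cases h : f x = a
  · simp only [h, if_true, ← Finset.mul_sum, (hK (c x)).2, mul_one]
  · simp [h]

lemma entOf_jointWeight_source {k : ℕ} (p : S → ℝ) (c : S → X) {K : X → Fin k × V → ℝ}
    (hK : IsKernel K) (f : S → P) :
    entOf (jointWeight p c K) (fun z => f z.1) = entOf p f := by
  simp only [entOf, distOf_jointWeight_source p c hK f]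

lemma sum_jointWeight {k : ℕ} (p : S → ℝ) (c : S → X) {K : X → Fin k × V → ℝ}
    (hK : IsKernel K) : ∑ z, jointWeight p c K z = ∑ x, p x := by
  rw [Fintype.sum_prod_type]
  simp only [jointWeight, ← Finset.mul_sum, (hK _).2, mul_one]

lemma entOf_mixKernel {k₁ k₂ : ℕ} {t s : ℝ} {p : S → ℝ} (hp : ∑ x, p x = 1) (c : S → X)
    {K₁ : X → Fin k₁ × V → ℝ} {K₂ : X → Fin k₂ × V → ℝ} (h₁ : IsKernel K₁) (h₂ : IsKernel K₂)
    (r : S → V → Q) :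
    entOf (jointWeight p c (mixKernel t s K₁ K₂)) (fun z => (z.2.1, r z.1 z.2.2)) =
      t * entOf (jointWeight p c K₁) (fun z => (z.2.1, r z.1 z.2.2))
      + s * entOf (jointWeight p c K₂) (fun z => (z.2.1, r z.1 z.2.2))
      + (-(t * Real.logb 2 t) - s * Real.logb 2 s) := by
  rw [entOf_disjoint_mixture (w₁ := jointWeight p c K₁) (w₂ := jointWeight p c K₂) (t := t) (s := s)
    (fun z => (z.1, Fin.castAdd k₂ z.2.1, z.2.2)) (fun z => (z.1, Fin.natAdd k₁ z.2.1, z.2.2))]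
  · congr 3
    · exact entOf_comp_injective (jointWeight p c K₁) (fun z => (z.2.1, r z.1 z.2.2))
        (Prod.map (Fin.castAdd k₂) id)
        ((Fin.castAdd_injective k₁ k₂).prodMap Function.injective_id)
    · exact entOf_comp_injective (jointWeight p c K₂) (fun z => (z.2.1, r z.1 z.2.2))
        (Prod.map (Fin.natAdd k₁) id)
        ((Fin.natAdd_injective k₂ k₁).prodMap Function.injective_id)
  · intro g
    simp only [Fintype.sum_prod_type, Fin.sum_univ_add, Finset.sum_add_distrib]
  · intro z
    simp only [jointWeight, mixKernel, Fin.addCases_left]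
    ring
  · intro z
    simp only [jointWeight, mixKernel, Fin.addCases_right]
    ring
  · rw [sum_jointWeight p c h₁, hp]
  · rw [sum_jointWeight p c h₂, hp]
  · intro z z' h
    have := congrArg (fun q => (Prod.fst q : Fin (k₁ + k₂)).val) h
    simp only [Fin.val_castAdd, Fin.val_natAdd] at this
    omega

lemma cmiOf_eq_of_cond_auxiliary {k : ℕ} (w : S × Fin k × V → ℝ) (c : S → X) (f : S → P)
    (g : V → Q) :
    cmiOf w (fun z => c z.1) (fun z => g z.2.2) (fun z => (z.2.1, f z.1)) =
      entOf w (fun z => (z.2.1, (c z.1, f z.1))) + entOf w (fun z => (z.2.1, (g z.2.2, f z.1)))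
      - entOf w (fun z => (z.2.1, (c z.1, g z.2.2, f z.1)))
      - entOf w (fun z => (z.2.1, f z.1)) := by
  unfold cmiOf
  congr 2
  · congr 1
    · exact entOf_comp_injective w (fun z => (z.2.1, (c z.1, f z.1)))
        (fun q => (q.2.1, q.1, q.2.2)) (by rintro ⟨_, _, _⟩ ⟨_, _, _⟩ h; simp_all)
    · exact entOf_comp_injective w (fun z => (z.2.1, (g z.2.2, f z.1)))
        (fun q => (q.2.1, q.1, q.2.2)) (by rintro ⟨_, _, _⟩ ⟨_, _, _⟩ h; simp_all)
  · exact entOf_comp_injective w (fun z => (z.2.1, (c z.1, g z.2.2, f z.1)))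
      (fun q => (q.2.1, q.2.2.1, q.1, q.2.2.2)) (by rintro ⟨_, _, _, _⟩ ⟨_, _, _, _⟩ h; simp_all)

lemma cmiOf_eq_of_joint_auxiliary {k : ℕ} (w : S × Fin k × V → ℝ) (c : S → X) (f : S → P)
    (g : V → Q) :
    cmiOf w (fun z => c z.1) (fun z => (z.2.1, g z.2.2)) (fun z => f z.1) =
      entOf w (fun z => (c z.1, f z.1)) + entOf w (fun z => (z.2.1, (g z.2.2, f z.1)))
      - entOf w (fun z => (z.2.1, (c z.1, g z.2.2, f z.1)))
      - entOf w (fun z => f z.1) := by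
  unfold cmiOf
  congr 2
  · congr 1
    exact entOf_comp_injective w (fun z => (z.2.1, (g z.2.2, f z.1)))
      (fun q => ((q.1, q.2.1), q.2.2)) (by rintro ⟨_, _, _⟩ ⟨_, _, _⟩ h; simp_all)
  · exact entOf_comp_injective w (fun z => (z.2.1, (c z.1, g z.2.2, f z.1)))
      (fun q => (q.2.1, (q.1, q.2.2.1), q.2.2.2))
      (by rintro ⟨_, _, _, _⟩ ⟨_, _, _, _⟩ h; simp_all)

lemma cmiOf_mixKernel_cond {k₁ k₂ : ℕ} {t s : ℝ} {p : S → ℝ} (hp : ∑ x, p x = 1) (c : S → X)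
    {K₁ : X → Fin k₁ × V → ℝ} {K₂ : X → Fin k₂ × V → ℝ} (h₁ : IsKernel K₁) (h₂ : IsKernel K₂)
    (f : S → P) (g : V → Q) :
    cmiOf (jointWeight p c (mixKernel t s K₁ K₂)) (fun z => c z.1) (fun z => g z.2.2)
        (fun z => (z.2.1, f z.1)) =
      t * cmiOf (jointWeight p c K₁) (fun z => c z.1) (fun z => g z.2.2)
        (fun z => (z.2.1, f z.1))
      + s * cmiOf (jointWeight p c K₂) (fun z => c z.1) (fun z => g z.2.2)
        (fun z => (z.2.1, f z.1)) := by
  simp only [cmiOf_eq_of_cond_auxiliary]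
  rw [entOf_mixKernel hp c h₁ h₂ (fun x _ => (c x, f x)),
    entOf_mixKernel hp c h₁ h₂ (fun x v => (g v, f x)),
    entOf_mixKernel hp c h₁ h₂ (fun x v => (c x, g v, f x)),
    entOf_mixKernel hp c h₁ h₂ (fun x _ => f x)]
  ring

lemma cmiOf_mixKernel_joint {k₁ k₂ : ℕ} {t s : ℝ} (ht : 0 ≤ t) (hs : 0 ≤ s) (hts : t + s = 1)
    {p : S → ℝ} (hp : ∑ x, p x = 1) (c : S → X)
    {K₁ : X → Fin k₁ × V → ℝ} {K₂ : X → Fin k₂ × V → ℝ} (h₁ : IsKernel K₁) (h₂ : IsKernel K₂)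
    (f : S → P) (g : V → Q) :
    cmiOf (jointWeight p c (mixKernel t s K₁ K₂)) (fun z => c z.1) (fun z => (z.2.1, g z.2.2))
        (fun z => f z.1) =
      t * cmiOf (jointWeight p c K₁) (fun z => c z.1) (fun z => (z.2.1, g z.2.2))
        (fun z => f z.1)
      + s * cmiOf (jointWeight p c K₂) (fun z => c z.1) (fun z => (z.2.1, g z.2.2))
        (fun z => f z.1) := by
  have hm := isKernel_mixKernel ht hs hts h₁ h₂
  simp only [cmiOf_eq_of_joint_auxiliary]
  rw [entOf_mixKernel hp c h₁ h₂ (fun x v => (g v, f x)),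
    entOf_mixKernel hp c h₁ h₂ (fun x v => (c x, g v, f x)),
    entOf_jointWeight_source p c hm (fun x => (c x, f x)),
    entOf_jointWeight_source p c h₁ (fun x => (c x, f x)),
    entOf_jointWeight_source p c h₂ (fun x => (c x, f x)),
    entOf_jointWeight_source p c hm f, entOf_jointWeight_source p c h₁ f,
    entOf_jointWeight_source p c h₂ f]
  obtain rfl : s = 1 - t := by linarith
  ring

end TimeSharing

lemma convex_comb_lt {t s a b a' b' : ℝ} (ht : 0 ≤ t) (hs : 0 ≤ s) (hts : t + s = 1)
    (ha : a < a') (hb : b < b') : t * a + s * b < t * a' + s * b' := by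
  obtain rfl : s = 1 - t := by linarith
  rcases ht.eq_or_lt with rfl | ht
  · simpa using hb
  · exact add_lt_add_of_lt_of_le (mul_lt_mul_of_pos_left ha ht)
      (mul_le_mul_of_nonneg_left hb.le hs)

/-- **Theorem 2 (convexity).** The region `R_LGW^{inner}` is convex. -/
theorem lgwInner_convex
    {X Y1 Y2 V1 V2 : Type*} [Fintype X] [Fintype Y1] [Fintype Y2] [Fintype V1] [Fintype V2]
    (PXY : X × Y1 × Y2 → ℝ) (PV1 : X → V1 → ℝ) (PV2 : X → V2 → ℝ)
    (hPXY : IsPMF PXY) (hPV1 : IsKernel PV1) (hPV2 : IsKernel PV2) :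
    Convex ℝ (LGWInner PXY PV1 PV2) := by
  refine Convex.closure ?_
  rintro ⟨R0, R1, R2⟩ ⟨hR0, hR1, hR2, k, K, hK, hKV1, hKV2, hc1, hc2, hc3, hc4⟩
    ⟨R0', R1', R2'⟩ ⟨hR0', hR1', hR2', k', K', hK', hKV1', hKV2', hc1', hc2', hc3', hc4'⟩
    t s ht hs hts
  have hp := hPXY.2
  dsimp only at hR0 hR1 hR2 hR0' hR1' hR2'
  refine ⟨by simp only [Prod.smul_mk, Prod.mk_add_mk, smul_eq_mul]; positivity,
    by simp only [Prod.smul_mk, Prod.mk_add_mk, smul_eq_mul]; positivity,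
    by simp only [Prod.smul_mk, Prod.mk_add_mk, smul_eq_mul]; positivity,
    k + k', mixKernel t s K K', isKernel_mixKernel ht hs hts hK hK', ?_, ?_, ?_, ?_, ?_, ?_⟩
  · intro x v
    simp only [mixKernel, Fin.sum_univ_add, Fin.addCases_left, Fin.addCases_right,
      ← Finset.mul_sum, hKV1, hKV1', ← add_mul, hts, one_mul]
  · intro x v
    simp only [mixKernel, Fin.sum_univ_add, Fin.addCases_left, Fin.addCases_right,
      ← Finset.mul_sum, hKV2, hKV2', ← add_mul, hts, one_mul]
  · exact (cmiOf_mixKernel_cond hp Prod.fst hK hK' (fun y => y.2.1) Prod.fst).trans_lt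
      (convex_comb_lt ht hs hts hc1 hc1')
  · exact (cmiOf_mixKernel_cond hp Prod.fst hK hK' (fun y => y.2.2) Prod.snd).trans_lt
      (convex_comb_lt ht hs hts hc2 hc2')
  · refine ((cmiOf_mixKernel_joint ht hs hts hp Prod.fst hK hK' (fun y => y.2.1)
      Prod.fst).trans_lt (convex_comb_lt ht hs hts hc3 hc3')).trans_eq ?_
    simp only [Prod.smul_mk, Prod.mk_add_mk, smul_eq_mul]
    ring
  · refine ((cmiOf_mixKernel_joint ht hs hts hp Prod.fst hK hK' (fun y => y.2.2)
      Prod.snd).trans_lt (convex_comb_lt ht hs hts hc4 hc4')).trans_eq ?_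
    simp only [Prod.smul_mk, Prod.mk_add_mk, smul_eq_mul]
    ring

end BCFB
end
end
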